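/- arXiv:1911.00178 — 2 statements merged into one kernel-verified Lean document; each statement's English description precedes it below -/
import Mathlib

section
/- There exist absolute constants c > 0, c' > 0 and n₀ ∈ ℕ such that for all n ≥ n₀ the following holds. Let K ⊆ ℝⁿ be a convex set with |vol(K) − 1/2| ≤ c · n^{−1/2} and with B(0ⁿ, c) ⊆ K. Let h_{1/2} : ℝⁿ → {−1,1} be defined by h_{1/2}(x) = 1 if ‖x‖₂ ≤ r_median and h_{1/2}(x) = −1 otherwise. Then Pr_{g ∼ N(0,1)ⁿ}[h_{1/2}(g) = K(g)] ≥ 1/2 + c'/n. -/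
open MeasureTheory ProbabilityTheory

/-- The standard Gaussian measure `N(0,1)ⁿ` on `ℝⁿ`. -/
noncomputable def stdGaussian (n : ℕ) : Measure (EuclideanSpace ℝ (Fin n)) :=
  (Measure.pi fun _ : Fin n => gaussianReal 0 1).map
    (EuclideanSpace.equiv (Fin n) ℝ).symm

open Classical in
/-- The `±1`-valued function associated to a set `K`. -/
noncomputable def pmInd {n : ℕ} (K : Set (EuclideanSpace ℝ (Fin n)))
    (x : EuclideanSpace ℝ (Fin n)) : ℝ :=
  if x ∈ K then 1 else -1

/-- The Gaussian volume of `K ⊆ ℝⁿ`. -/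
noncomputable def gaussVol (n : ℕ) (K : Set (EuclideanSpace ℝ (Fin n))) : ℝ :=
  (stdGaussian n K).toReal

section GaussianDensity

variable {E : Type*} [NormedAddCommGroup E] [InnerProductSpace ℝ E] [FiniteDimensional ℝ E]
  [MeasurableSpace E] [BorelSpace E]

/-- The radial profile of the density of the standard Gaussian measure in dimension `d`. -/
noncomputable def gaussianRadialDensity (d : ℕ) (r : ℝ) : ℝ :=
  ((2 * Real.pi) ^ ((d : ℝ) / 2))⁻¹ * Real.exp (-(1 / 2) * r ^ 2)

lemma gaussianRadialDensity_nonneg (d : ℕ) (r : ℝ) : 0 ≤ gaussianRadialDensity d r := by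
  unfold gaussianRadialDensity; positivity

@[fun_prop]
lemma measurable_gaussianRadialDensity (d : ℕ) : Measurable (gaussianRadialDensity d) := by
  unfold gaussianRadialDensity; fun_prop

lemma integral_gaussianRadialDensity_norm :
    ∫ v : E, gaussianRadialDensity (Module.finrank ℝ E) ‖v‖ = 1 := by
  simp only [gaussianRadialDensity]
  rw [integral_const_mul, GaussianFourier.integral_rexp_neg_mul_sq_norm (by norm_num)]
  rw [show Real.pi / (1 / 2) = 2 * Real.pi by ring]
  exact inv_mul_cancel₀ (by positivity)

lemma integrable_gaussianRadialDensity_norm :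
    Integrable (fun v : E ↦ gaussianRadialDensity (Module.finrank ℝ E) ‖v‖) := by
  refine Integrable.of_integral_ne_zero ?_
  rw [integral_gaussianRadialDensity_norm]
  exact one_ne_zero

lemma stdGaussian_eq_withDensity :
    ProbabilityTheory.stdGaussian E = (volume : Measure E).withDensity
      fun v ↦ ENNReal.ofReal (gaussianRadialDensity (Module.finrank ℝ E) ‖v‖) := by
  have : IsFiniteMeasure ((volume : Measure E).withDensity
      fun v ↦ ENNReal.ofReal (gaussianRadialDensity (Module.finrank ℝ E) ‖v‖)) :=
    isFiniteMeasure_withDensity_ofReal integrable_gaussianRadialDensity_norm.2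
  refine Measure.ext_of_charFun ?_
  ext t
  rw [charFun_stdGaussian, charFun_apply,
    integral_withDensity_eq_integral_toReal_smul (by fun_prop) (by simp)]
  have key := GaussianFourier.integral_cexp_neg_mul_sq_norm_add (V := E)
    (b := ((1 / 2 : ℝ) : ℂ)) (by norm_num) Complex.I t
  have e : ∀ v : E, (ENNReal.ofReal (gaussianRadialDensity (Module.finrank ℝ E) ‖v‖)).toReal •
      Complex.exp (inner ℝ v t * Complex.I) =
      (((2 * Real.pi) ^ ((Module.finrank ℝ E : ℝ) / 2))⁻¹ : ℝ) *
      Complex.exp (-((1 / 2 : ℝ) : ℂ) * ‖v‖ ^ 2 + Complex.I * inner ℝ t v) := by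
    intro v
    rw [ENNReal.toReal_ofReal (gaussianRadialDensity_nonneg _ _), gaussianRadialDensity,
      Complex.exp_add, Complex.real_smul, real_inner_comm v t, mul_comm Complex.I]
    push_cast
    ring
  simp_rw [e]
  rw [integral_const_mul, key, ← mul_assoc]
  have h1 : (((Real.pi : ℂ) / ((1 / 2 : ℝ) : ℂ)) ^ ((Module.finrank ℝ E : ℂ) / 2)) =
      (((2 * Real.pi) ^ ((Module.finrank ℝ E : ℝ) / 2) : ℝ) : ℂ) := by
    rw [Complex.ofReal_cpow (by positivity)]
    push_cast
    congr 1
    ring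
  rw [h1, ← Complex.ofReal_mul, inv_mul_cancel₀ (by positivity)]
  simp only [Complex.I_sq]
  push_cast
  rw [one_mul]
  congr 1
  ring

lemma stdGaussian_absolutelyContinuous :
    ProbabilityTheory.stdGaussian E ≪ (volume : Measure E) := by
  rw [stdGaussian_eq_withDensity]
  exact withDensity_absolutelyContinuous _ _

/-- For the standard Gaussian measure, norm and direction are independent. -/
lemma stdGaussian_norm_inter_cone [Nontrivial E] {C : Set E} (hC : MeasurableSet C)
    (hcone : ∀ (r : ℝ) (x : E), 0 < r → (r • x ∈ C ↔ x ∈ C)) {s : Set ℝ} (hs : MeasurableSet s) :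
    ProbabilityTheory.stdGaussian E ({x | ‖x‖ ∈ s} ∩ C) =
      ProbabilityTheory.stdGaussian E {x | ‖x‖ ∈ s} * ProbabilityTheory.stdGaussian E C := by
  set φ : ℝ → ENNReal := fun r ↦ ENNReal.ofReal (gaussianRadialDensity (Module.finrank ℝ E) r)
  have hφ : Measurable φ := by fun_prop
  set w : Set ℝ → ENNReal := fun s ↦ ∫⁻ r : Set.Ioi (0 : ℝ), s.indicator φ r
    ∂(Measure.volumeIoiPow (Module.finrank ℝ E - 1))
  have key : ∀ (C : Set E), MeasurableSet C →
      (∀ (r : ℝ) (x : E), 0 < r → (r • x ∈ C ↔ x ∈ C)) → ∀ s : Set ℝ, MeasurableSet s →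
      ProbabilityTheory.stdGaussian E ({x | ‖x‖ ∈ s} ∩ C) =
        (volume : Measure E).toSphere (Subtype.val ⁻¹' C) * w s := by
    intro C hC hcone s hs
    have hns : MeasurableSet ({x : E | ‖x‖ ∈ s} ∩ C) := (measurable_norm hs).inter hC
    have hC' : MeasurableSet (Subtype.val ⁻¹' C : Set (Metric.sphere (0 : E) 1)) :=
      measurable_subtype_coe hC
    have hsub : ProbabilityTheory.stdGaussian E ({x | ‖x‖ ∈ s} ∩ C) =
        ∫⁻ x : ({0}ᶜ : Set E), ({x : E | ‖x‖ ∈ s} ∩ C).indicator (fun v ↦ φ ‖v‖) x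
          ∂((volume : Measure E).comap (↑)) := by
      rw [stdGaussian_eq_withDensity, withDensity_apply _ hns, ← lintegral_indicator hns,
        lintegral_subtype_comap (measurableSet_singleton _).compl, restrict_compl_singleton]
    rw [hsub]
    have hprod : (volume : Measure E).toSphere (Subtype.val ⁻¹' C) * w s =
        ∫⁻ z, (Subtype.val ⁻¹' C).indicator 1 z.1 * s.indicator φ z.2
          ∂((volume : Measure E).toSphere.prod
            (Measure.volumeIoiPow (Module.finrank ℝ E - 1))) := by
      rw [lintegral_prod_mul (g := fun r : Set.Ioi (0 : ℝ) ↦ s.indicator φ r)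
        (measurable_one.indicator hC').aemeasurable
        ((hφ.indicator hs).comp measurable_subtype_coe).aemeasurable, lintegral_indicator_one hC']
    rw [hprod, ← (volume : Measure E).measurePreserving_homeomorphUnitSphereProd.lintegral_comp_emb
        (Homeomorph.measurableEmbedding _)]
    refine lintegral_congr fun x ↦ ?_
    have hx : 0 < ‖(x : E)‖ := norm_pos_iff.2 x.2
    have h1 := hcone ‖(x : E)‖⁻¹ x (inv_pos.2 hx)
    simp only [Set.indicator, Set.mem_preimage, homeomorphUnitSphereProd_apply_fst_coe,
      homeomorphUnitSphereProd_apply_snd_coe, h1, Set.mem_inter_iff, Set.mem_ofPred_eq]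
    by_cases hxs : ‖(x : E)‖ ∈ s <;> by_cases hxC : (x : E) ∈ C <;> simp_all
  have h1 := key C hC hcone s hs
  have h2 := key C hC hcone Set.univ .univ
  have h3 := key Set.univ .univ (by simp) s hs
  have h4 := key Set.univ .univ (by simp) Set.univ .univ
  simp only [Set.mem_univ, Set.ofPred_true, Set.univ_inter, Set.inter_univ, measure_univ] at h2 h3 h4
  rw [h1, h2, h3]
  calc _ = (volume : Measure E).toSphere (Subtype.val ⁻¹' C) * w s * 1 := by rw [mul_one]
    _ = _ := by rw [h4]; ring

lemma stdGaussian_real_eq_integral {A : Set E} (hA : MeasurableSet A) :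
    (ProbabilityTheory.stdGaussian E).real A =
      ∫ x : E, A.indicator (fun v ↦ gaussianRadialDensity (Module.finrank ℝ E) ‖v‖) x := by
  rw [measureReal_def, stdGaussian_eq_withDensity, withDensity_apply _ hA, integral_indicator hA,
    integral_eq_lintegral_of_nonneg_ae
      (Filter.Eventually.of_forall fun x ↦ gaussianRadialDensity_nonneg _ _)
      integrable_gaussianRadialDensity_norm.aestronglyMeasurable.restrict]

/-- A lower bound for the standard Gaussian measure of the dilate `κ • A`. -/
lemma mul_stdGaussian_le_stdGaussian_dilate {κ a : ℝ} (hκ : 0 < κ) {A : Set E}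
    (hA : MeasurableSet A)
    (h : ∀ x ∈ A, a ≤ κ ^ Module.finrank ℝ E * Real.exp ((1 - κ ^ 2) / 2 * ‖x‖ ^ 2)) :
    a * (ProbabilityTheory.stdGaussian E).real A ≤
      (ProbabilityTheory.stdGaussian E).real {x | κ⁻¹ • x ∈ A} := by
  have hS : MeasurableSet {x : E | κ⁻¹ • x ∈ A} := measurable_const_smul κ⁻¹ hA
  have hint := integrable_gaussianRadialDensity_norm (E := E)
  set f : E → ℝ := {x : E | κ⁻¹ • x ∈ A}.indicator
    (fun v ↦ gaussianRadialDensity (Module.finrank ℝ E) ‖v‖)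
  have hf : Integrable f := hint.indicator hS
  have hscale := Measure.integral_comp_smul (volume : Measure E) f κ
  rw [abs_of_pos (by positivity), smul_eq_mul, inv_mul_eq_div, eq_div_iff (by positivity)] at hscale
  rw [stdGaussian_real_eq_integral hS, stdGaussian_real_eq_integral hA, ← hscale, mul_comm,
    mul_comm _ (κ ^ _), ← integral_mul_const, ← integral_const_mul]
  refine integral_mono ((hint.indicator hA).mul_const a)
    ((hf.comp_smul hκ.ne').const_mul _) fun x ↦ ?_
  have hx : κ⁻¹ • κ • x = x := inv_smul_smul₀ hκ.ne' x
  by_cases hxA : x ∈ A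
  · have hd : gaussianRadialDensity (Module.finrank ℝ E) ‖κ • x‖ =
        gaussianRadialDensity (Module.finrank ℝ E) ‖x‖ *
          Real.exp ((1 - κ ^ 2) / 2 * ‖x‖ ^ 2) := by
      rw [gaussianRadialDensity, gaussianRadialDensity, mul_assoc, ← Real.exp_add, norm_smul,
        Real.norm_of_nonneg hκ.le]
      ring_nf
    simp only [f, Set.indicator, Set.mem_ofPred_eq, hx, hxA, if_true, hd]
    calc _ ≤ _ := mul_le_mul_of_nonneg_left (h x hxA) (gaussianRadialDensity_nonneg _ _)
      _ = _ := by ring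
  · simp [f, Set.indicator, hx, hxA]

end GaussianDensity

section Coupling

variable {E : Type*} [NormedAddCommGroup E] [InnerProductSpace ℝ E] [FiniteDimensional ℝ E]
  [MeasurableSpace E] [BorelSpace E]

lemma measurePreserving_rotation_stdGaussian (θ : ℝ) :
    MeasurePreserving (ContinuousLinearMap.rotation (E := E) θ)
      ((ProbabilityTheory.stdGaussian E).prod (ProbabilityTheory.stdGaussian E))
      ((ProbabilityTheory.stdGaussian E).prod (ProbabilityTheory.stdGaussian E)) :=
  ⟨(ContinuousLinearMap.rotation θ).continuous.measurable,
    IsGaussian.map_rotation_eq_self (by simp) θ⟩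

lemma stdGaussian_prod_mem_rotation (k : ℕ) (θ : ℝ) {C : Set E} (hC : MeasurableSet C) :
    ((ProbabilityTheory.stdGaussian E).prod (ProbabilityTheory.stdGaussian E)).real
      {z | z.1 ∈ C ∧ (ContinuousLinearMap.rotation (k * θ) z).1 ∉ C} ≤
    k * ((ProbabilityTheory.stdGaussian E).prod (ProbabilityTheory.stdGaussian E)).real
      {z | z.1 ∈ C ∧ (ContinuousLinearMap.rotation θ z).1 ∉ C} := by
  induction k with
  | zero => simp [ContinuousLinearMap.rotation_apply]
  | succ k ih =>
    have hcomp : ∀ z : E × E, (ContinuousLinearMap.rotation (((k + 1 : ℕ) : ℝ) * θ) z).1 =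
        (ContinuousLinearMap.rotation θ (ContinuousLinearMap.rotation (k * θ) z)).1 := by
      intro z
      simp only [ContinuousLinearMap.rotation_apply, Nat.cast_add, Nat.cast_one, add_mul, one_mul,
        Real.cos_add, Real.sin_add]
      module
    have hmeas : MeasurableSet {z : E × E | z.1 ∈ C ∧ (ContinuousLinearMap.rotation θ z).1 ∉ C} :=
      (measurable_fst hC).inter
        ((measurable_fst.comp (ContinuousLinearMap.rotation θ).continuous.measurable) hC).compl
    have hpre := (measurePreserving_rotation_stdGaussian (E := E) (k * θ)).measureReal_preimage
      hmeas.nullMeasurableSet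
    have hsub : {z : E × E | z.1 ∈ C ∧
        (ContinuousLinearMap.rotation (((k + 1 : ℕ) : ℝ) * θ) z).1 ∉ C} ⊆
        {z | z.1 ∈ C ∧ (ContinuousLinearMap.rotation (k * θ) z).1 ∉ C} ∪
        ContinuousLinearMap.rotation (k * θ) ⁻¹'
          {z | z.1 ∈ C ∧ (ContinuousLinearMap.rotation θ z).1 ∉ C} := by
      rintro z ⟨h1, h2⟩
      rw [hcomp] at h2
      by_cases h : (ContinuousLinearMap.rotation (k * θ) z).1 ∈ C
      · exact Or.inr ⟨h, h2⟩
      · exact Or.inl ⟨h1, h⟩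
    have := (measureReal_mono
      (μ := (ProbabilityTheory.stdGaussian E).prod (ProbabilityTheory.stdGaussian E)) hsub).trans
      (measureReal_union_le _ _)
    rw [hpre] at this
    push_cast at this ⊢
    linarith

/-- Moving along the circular interpolation between two independent Gaussian vectors in `N` equal
steps, the boundary of `C` is crossed in a single step with probability at least a `1 / N`
fraction of the variance of its indicator. -/
lemma stdGaussian_mul_le_crossing {N : ℕ} (hN : N ≠ 0) {C : Set E} (hC : MeasurableSet C) :
    (ProbabilityTheory.stdGaussian E).real C * (1 - (ProbabilityTheory.stdGaussian E).real C) ≤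
    N * ((ProbabilityTheory.stdGaussian E).prod (ProbabilityTheory.stdGaussian E)).real
      {z | z.1 ∈ C ∧ (ContinuousLinearMap.rotation (Real.pi / (2 * N)) z).1 ∉ C} := by
  have h := stdGaussian_prod_mem_rotation N (Real.pi / (2 * N)) hC
  have hN' : (N : ℝ) ≠ 0 := by exact_mod_cast hN
  have hθ : (N : ℝ) * (Real.pi / (2 * N)) = Real.pi / 2 := by field_simp
  have hset : {z : E × E | z.1 ∈ C ∧
      (ContinuousLinearMap.rotation ((N : ℝ) * (Real.pi / (2 * N))) z).1 ∉ C} = C ×ˢ Cᶜ := by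
    ext z
    simp [hθ, ContinuousLinearMap.rotation_apply]
  rw [hset, measureReal_prod_prod, probReal_compl_eq_one_sub hC] at h
  exact h

end Coupling

section NormConcentration

lemma integral_pow_four_gaussianReal_le : ∫ x, x ^ 4 ∂(gaussianReal 0 1) ≤ 80 := by
  have hexp : ∀ x : ℝ, x ^ 4 ≤ 24 * (Real.exp (1 * x) + Real.exp (-1 * x)) := by
    intro x
    have h := Real.pow_div_factorial_le_exp |x| (abs_nonneg x) 4
    have h4 : |x| ^ 4 = x ^ 4 := Even.pow_abs (by decide) x
    rw [h4] at h
    norm_num [Nat.factorial] at h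
    have h2 : Real.exp |x| ≤ Real.exp (1 * x) + Real.exp (-1 * x) := by
      rcases abs_cases x with ⟨h, -⟩ | ⟨h, -⟩ <;> rw [h] <;> simp [Real.exp_nonneg]
    linarith
  have hm : ∀ t : ℝ, ∫ x, Real.exp (t * x) ∂(gaussianReal 0 1) = Real.exp (t ^ 2 / 2) := by
    intro t
    have := congrFun (mgf_id_gaussianReal (μ := 0) (v := 1)) t
    simpa [mgf] using this
  have hi := fun t ↦ integrable_exp_mul_gaussianReal (μ := 0) (v := 1) t
  calc ∫ x, x ^ 4 ∂(gaussianReal 0 1)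
      ≤ ∫ x, 24 * (Real.exp (1 * x) + Real.exp (-1 * x)) ∂(gaussianReal 0 1) :=
        integral_mono_of_nonneg (.of_forall fun x ↦ by positivity)
          (((hi 1).add (hi (-1))).const_mul 24) (.of_forall hexp)
    _ = 48 * Real.exp (1 / 2) := by
        rw [integral_const_mul, integral_add (hi 1) (hi (-1)), hm, hm]
        norm_num
        ring
    _ ≤ 80 := by
        have h1 : Real.exp (1 / 2) ^ 2 = Real.exp 1 := by
          rw [← Real.exp_nat_mul]; norm_num
        have h2 := Real.exp_one_lt_d9
        have h3 : Real.exp (1 / 2) ≤ 5 / 3 := by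
          refine le_of_sq_le_sq ?_ (by norm_num)
          rw [h1]; linarith
        linarith

lemma memLp_sq_gaussianReal : MemLp (fun x : ℝ ↦ x ^ 2) 2 (gaussianReal 0 1) := by
  rw [memLp_two_iff_integrable_sq (by fun_prop)]
  refine ((memLp_id_gaussianReal (μ := 0) (v := 1) 4).integrable_norm_pow (p := 4)
    (by norm_num)).congr (.of_forall fun x ↦ ?_)
  simp only [id, Real.norm_eq_abs, Even.pow_abs (by decide : Even 4)]
  ring

lemma variance_sq_gaussianReal_le : Var[fun x : ℝ ↦ x ^ 2; gaussianReal 0 1] ≤ 80 := by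
  refine (variance_le_expectation_sq memLp_sq_gaussianReal.aestronglyMeasurable).trans ?_
  refine le_of_eq_of_le ?_ integral_pow_four_gaussianReal_le
  congr 1; ext x; simp; ring

lemma integral_sq_gaussianReal : ∫ x, x ^ 2 ∂(gaussianReal 0 1) = 1 := by
  have h := variance_eq_sub (memLp_id_gaussianReal (μ := 0) (v := 1) 2)
  rw [variance_id_gaussianReal] at h
  simpa using h.symm

/-- Concentration of the squared norm of a standard Gaussian vector, from Chebyshev. -/
lemma stdGaussian_abs_normSq_sub_ge_le (n : ℕ) {c : ℝ} (hc : 0 < c) :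
    (ProbabilityTheory.stdGaussian (EuclideanSpace ℝ (Fin n))).real
      {x | c ≤ |‖x‖ ^ 2 - (n : ℝ)|} ≤ 80 * n / c ^ 2 := by
  set P : Measure (Fin n → ℝ) := Measure.pi fun _ : Fin n ↦ gaussianReal 0 1
  set X : (Fin n → ℝ) → ℝ := ∑ i : Fin n, fun ω ↦ (ω i) ^ 2
  have hXi : ∀ i : Fin n, MemLp (fun ω : Fin n → ℝ ↦ (ω i) ^ 2) 2 P := fun i ↦
    memLp_sq_gaussianReal.comp_measurePreserving (measurePreserving_eval _ i)
  have hX : MemLp X 2 P := memLp_finsetSum' _ fun i _ ↦ hXi i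
  have hvar : Var[X; P] ≤ 80 * n := by
    have h := variance_sum_pi (μ := fun _ : Fin n ↦ gaussianReal 0 1)
      (X := fun _ x ↦ x ^ 2) fun _ ↦ memLp_sq_gaussianReal
    rw [h]
    refine (Finset.sum_le_card_nsmul _ _ 80 fun i _ ↦ variance_sq_gaussianReal_le).trans ?_
    simp [mul_comm]
  have hmean : P[X] = (n : ℝ) := by
    have : X = fun ω ↦ ∑ i : Fin n, (ω i) ^ 2 := by ext; simp [X]
    rw [this, integral_finsetSum _ fun i _ ↦ (hXi i).integrable (by norm_num)]
    have hi : ∀ i : Fin n, ∫ ω, (ω i) ^ 2 ∂P = 1 := fun i ↦ by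
      rw [← integral_sq_gaussianReal, ← (measurePreserving_eval
        (fun _ : Fin n ↦ gaussianReal 0 1) i).map_eq, integral_map
        (measurable_pi_apply i).aemeasurable (by fun_prop)]
    simp [hi]
  have hcheb := meas_ge_le_variance_div_sq hX hc
  have hset : WithLp.toLp 2 ⁻¹' {x : EuclideanSpace ℝ (Fin n) | c ≤ |‖x‖ ^ 2 - n|} =
      {ω | c ≤ |X ω - P[X]|} := by
    ext ω
    have h : ‖WithLp.toLp 2 ω‖ ^ 2 = X ω := by simp [X, EuclideanSpace.norm_sq_eq]
    rw [Set.mem_preimage, Set.mem_ofPred_eq, Set.mem_ofPred_eq, hmean, h]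
  rw [← map_pi_eq_stdGaussian, map_measureReal_apply (by fun_prop)
    (measurableSet_le measurable_const (by fun_prop)), hset, measureReal_def]
  refine (ENNReal.toReal_le_of_le_ofReal
    (div_nonneg (variance_nonneg _ _) (sq_nonneg c)) hcheb).trans ?_
  gcongr

lemma le_two_mul_sqrt_of_stdGaussian_closedBall {n : ℕ} (hn : 100 ≤ n) {r : ℝ}
    (hr : (ProbabilityTheory.stdGaussian (EuclideanSpace ℝ (Fin n))).real
      {x | ‖x‖ ∈ Set.Iic r} = 1 / 2) : r ≤ 2 * √n := by
  by_contra! hlt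
  have hn' : (100 : ℝ) ≤ n := by exact_mod_cast hn
  have hsq : √(n : ℝ) ^ 2 = n := Real.sq_sqrt (by positivity)
  have hs := Real.sqrt_nonneg (n : ℝ)
  have hmeas : MeasurableSet {x : EuclideanSpace ℝ (Fin n) | ‖x‖ ∈ Set.Iic r} :=
    measurable_norm measurableSet_Iic
  have h1 := stdGaussian_abs_normSq_sub_ge_le n (c := 3 * n) (by positivity)
  have h2 := probReal_compl_eq_one_sub
    (μ := ProbabilityTheory.stdGaussian (EuclideanSpace ℝ (Fin n))) hmeas
  have hsub : {x : EuclideanSpace ℝ (Fin n) | ‖x‖ ∈ Set.Iic r}ᶜ ⊆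
      {x | 3 * (n : ℝ) ≤ |‖x‖ ^ 2 - (n : ℝ)|} := by
    intro x hx
    simp only [Set.mem_compl_iff, Set.mem_ofPred_eq, Set.mem_Iic, not_le] at hx ⊢
    refine le_trans ?_ (le_abs_self _)
    nlinarith
  have h3 := (measureReal_mono
    (μ := ProbabilityTheory.stdGaussian (EuclideanSpace ℝ (Fin n))) hsub).trans h1
  rw [h2, hr, le_div_iff₀ (by positivity)] at h3
  nlinarith

/-- Shrinking the centered ball of median radius by a factor `1 - 1 / √n` leaves it with at least a
constant amount of Gaussian mass. -/
lemma exp_le_stdGaussian_closedBall_sub {n : ℕ} (hn : 1000 ≤ n) {r : ℝ}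
    (hr : (ProbabilityTheory.stdGaussian (EuclideanSpace ℝ (Fin n))).real
      {x | ‖x‖ ∈ Set.Iic r} = 1 / 2) :
    Real.exp (-23) / 4 ≤ (ProbabilityTheory.stdGaussian (EuclideanSpace ℝ (Fin n))).real
      {x | ‖x‖ ∈ Set.Iic ((1 - 1 / √n) * r)} := by
  have hn' : (1000 : ℝ) ≤ n := by exact_mod_cast hn
  have hsq : √(n : ℝ) ^ 2 = n := Real.sq_sqrt (by positivity)
  set q := √(n : ℝ) with hq
  have hq1 : 20 ≤ q := Real.le_sqrt_of_sq_le (by linarith)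
  set s : ℝ := 1 / q with hs
  have hs0 : 0 < s := by positivity
  have hsq1 : s * q = 1 := by rw [hs]; field_simp
  have hs1 : s ≤ 1 / 2 := by nlinarith
  have hκ : 0 < 1 - s := by linarith
  set A : Set (EuclideanSpace ℝ (Fin n)) := {x | ‖x‖ ∈ Set.Iic r} \
    {x | 20 * q ≤ |‖x‖ ^ 2 - (n : ℝ)|} with hA
  have hAm : MeasurableSet A := (measurable_norm measurableSet_Iic).diff
    (measurableSet_le measurable_const (by fun_prop))
  have hA4 : 1 / 4 ≤ (ProbabilityTheory.stdGaussian (EuclideanSpace ℝ (Fin n))).real A := by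
    have h1 := stdGaussian_abs_normSq_sub_ge_le n (c := 20 * q) (by positivity)
    have h2 : 80 * n / (20 * q) ^ 2 = (1 / 5 : ℝ) := by
      rw [mul_pow, hsq]; field_simp; norm_num
    have h3 := le_measureReal_sdiff (μ := ProbabilityTheory.stdGaussian (EuclideanSpace ℝ (Fin n)))
      (s₁ := {x | ‖x‖ ∈ Set.Iic r}) (s₂ := {x | 20 * q ≤ |‖x‖ ^ 2 - (n : ℝ)|})
    linarith
  have hlog : -s - 2 * s ^ 2 ≤ Real.log (1 - s) := by
    refine le_trans ?_ (Real.one_sub_inv_le_log_of_pos hκ)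
    have : (1 - s)⁻¹ ≤ 1 + s + 2 * s ^ 2 := by
      rw [inv_le_iff_one_le_mul₀ hκ]
      nlinarith [mul_nonneg (sq_nonneg s) (by linarith : 0 ≤ 1 - 2 * s)]
    linarith
  have h := mul_stdGaussian_le_stdGaussian_dilate (E := EuclideanSpace ℝ (Fin n)) hκ hAm
    (a := Real.exp (-23)) (by
      intro x hx
      have hx2 : n - 20 * q ≤ ‖x‖ ^ 2 := by
        have := hx.2
        simp only [Set.mem_ofPred_eq, not_le, abs_lt] at this
        linarith [this.1]
      rw [finrank_euclideanSpace_fin, ← Real.exp_log hκ, ← Real.exp_nat_mul, ← Real.exp_add,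
        Real.exp_log hκ]
      refine Real.exp_le_exp.2 ?_
      have e1 := mul_le_mul_of_nonneg_left hlog (by positivity : (0 : ℝ) ≤ n)
      have e2 := mul_le_mul_of_nonneg_left hx2 (by nlinarith : 0 ≤ (1 - (1 - s) ^ 2) / 2)
      have e3 : (n : ℝ) * (-s - 2 * s ^ 2) = -q - 2 := by
        rw [← hsq]; linear_combination (-q - 2 * (s * q) - 2) * hsq1
      have e4 : (1 - (1 - s) ^ 2) / 2 * (n - 20 * q) = q - 20 - 1 / 2 + 10 * s := by
        rw [← hsq]
        linear_combination (q - 20 - s * q / 2 - 1 / 2 + 10 * s) * hsq1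
      linarith)
  have hsub : {x : EuclideanSpace ℝ (Fin n) | (1 - s)⁻¹ • x ∈ A} ⊆
      {x | ‖x‖ ∈ Set.Iic ((1 - s) * r)} := by
    intro x hx
    have h1 : ‖(1 - s)⁻¹ • x‖ ≤ r := hx.1
    rw [norm_smul, Real.norm_of_nonneg (by positivity), inv_mul_le_iff₀ hκ] at h1
    exact h1
  have h5 := h.trans (measureReal_mono hsub)
  have := Real.exp_pos (-23)
  nlinarith

end NormConcentration

section Sublinear

variable {n : ℕ} {p : EuclideanSpace ℝ (Fin n) → ℝ} {c : ℝ}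

/-- The cone of points at which a positively homogeneous function `p` is less than `t * ‖x‖`. -/
def sublevelCone {E : Type*} [Norm E] (p : E → ℝ) (t : ℝ) : Set E := {x | p x < t * ‖x‖}

lemma measurableSet_sublevelCone (hp : Measurable p) (t : ℝ) :
    MeasurableSet (sublevelCone p t) :=
  measurableSet_lt hp (by fun_prop)

lemma sublevelCone_mono {s t : ℝ} (hst : s ≤ t) : sublevelCone p s ⊆ sublevelCone p t :=
  fun x hx ↦ lt_of_lt_of_le hx (mul_le_mul_of_nonneg_right hst (norm_nonneg x))

lemma smul_mem_sublevelCone_iff (hsmul : ∀ (r : ℝ) x, 0 ≤ r → p (r • x) = r * p x) (t r : ℝ)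
    (x : EuclideanSpace ℝ (Fin n)) (hr : 0 < r) :
    r • x ∈ sublevelCone p t ↔ x ∈ sublevelCone p t := by
  simp only [sublevelCone, Set.mem_ofPred_eq, hsmul r x hr.le, norm_smul, Real.norm_of_nonneg hr.le]
  rw [mul_left_comm, mul_lt_mul_iff_right₀ hr]

/-- An isoperimetric-type estimate for the sublevel cones of a sublinear function. -/
lemma stdGaussian_sublevelCone_increment (hn : 0 < n) (hc : 0 < c) (hp : Measurable p)
    (hsmul : ∀ (r : ℝ) x, 0 ≤ r → p (r • x) = r * p x) (hadd : ∀ x y, p (x + y) ≤ p x + p y)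
    (hle : ∀ x, p x ≤ ‖x‖ / c) {t : ℝ} (ht : 0 < t) {N : ℕ} (hN : N ≠ 0) :
    (ProbabilityTheory.stdGaussian (EuclideanSpace ℝ (Fin n))).real (sublevelCone p t) *
      (1 - (ProbabilityTheory.stdGaussian (EuclideanSpace ℝ (Fin n))).real (sublevelCone p t)) ≤
    N * ((ProbabilityTheory.stdGaussian (EuclideanSpace ℝ (Fin n))).real
        (sublevelCone p (t + 2 * (Real.pi / (2 * N)) * (t + 1 / c))) -
      (ProbabilityTheory.stdGaussian (EuclideanSpace ℝ (Fin n))).real (sublevelCone p t) +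
      640 / n) := by
  refine (stdGaussian_mul_le_crossing hN (measurableSet_sublevelCone hp t)).trans ?_
  refine mul_le_mul_of_nonneg_left ?_ (Nat.cast_nonneg N)
  have hN1 : (1 : ℝ) ≤ N := by exact_mod_cast Nat.one_le_iff_ne_zero.2 hN
  have hn0 : (0 : ℝ) < n := by exact_mod_cast hn
  have hθ0 : 0 < Real.pi / (2 * N) := by have := Real.pi_pos; positivity
  have hθ1 : Real.pi / (2 * N) ≤ Real.pi / 2 := by
    have := Real.pi_pos
    gcongr
    linarith
  set θ := Real.pi / (2 * N)
  have hcos : 0 ≤ Real.cos θ := Real.cos_nonneg_of_neg_pi_div_two_le_of_le (by linarith) hθ1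
  have hsin : 0 < Real.sin θ := Real.sin_pos_of_pos_of_lt_pi hθ0 (by linarith [Real.pi_pos])
  set t' := t + 2 * θ * (t + 1 / c)
  have htt' : t ≤ t' := le_add_of_nonneg_right (by positivity)
  set γ := ProbabilityTheory.stdGaussian (EuclideanSpace ℝ (Fin n))
  set bad : Set (EuclideanSpace ℝ (Fin n)) := {x | (n : ℝ) / 2 ≤ |‖x‖ ^ 2 - (n : ℝ)|}
  have hbadm : MeasurableSet bad := measurableSet_le measurable_const (by fun_prop)
  have hbad : γ.real bad ≤ 320 / n := by
    refine (stdGaussian_abs_normSq_sub_ge_le n (by positivity)).trans (le_of_eq ?_)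
    field_simp
    norm_num
  have hCm := measurableSet_sublevelCone hp
  have hdm := (hCm t').diff (hCm t)
  have hsub : {z : EuclideanSpace ℝ (Fin n) × EuclideanSpace ℝ (Fin n) | z.1 ∈ sublevelCone p t ∧
      (ContinuousLinearMap.rotation θ z).1 ∉ sublevelCone p t} ⊆
      ContinuousLinearMap.rotation θ ⁻¹' (Prod.fst ⁻¹' (sublevelCone p t' \ sublevelCone p t)) ∪
        (Prod.snd ⁻¹' bad ∪ ContinuousLinearMap.rotation θ ⁻¹' (Prod.fst ⁻¹' bad)) := by
    rintro ⟨x, y⟩ ⟨hx, hx'⟩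
    by_contra hcon
    simp only [Set.mem_union, Set.mem_preimage, Set.mem_sdiff, not_or, not_and, bad,
      Set.mem_ofPred_eq, not_le, hx', not_false_eq_true, not_true_eq_false, imp_false,
      abs_lt] at hcon
    obtain ⟨hz, hy, hz'⟩ := hcon
    refine hz ?_
    have hzdef : (ContinuousLinearMap.rotation θ (x, y)).1 = Real.cos θ • x + Real.sin θ • y := rfl
    rw [hzdef] at hz' ⊢
    set z := Real.cos θ • x + Real.sin θ • y with hzeq
    have hyz : ‖y‖ < 2 * ‖z‖ :=
      lt_of_pow_lt_pow_left₀ 2 (by positivity) (by nlinarith [hy.2, hz'.1])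
    have hpx : p x < t * ‖x‖ := hx
    have h1 : p z ≤ Real.cos θ * p x + Real.sin θ * p y := by
      rw [← hsmul _ _ hcos, ← hsmul _ _ hsin.le]; exact hadd _ _
    have h2 : Real.cos θ * ‖x‖ ≤ ‖z‖ + Real.sin θ * ‖y‖ := by
      have : Real.cos θ • x = z - Real.sin θ • y := by rw [hzeq]; abel
      calc _ = ‖Real.cos θ • x‖ := by rw [norm_smul, Real.norm_of_nonneg hcos]
        _ ≤ ‖z‖ + ‖Real.sin θ • y‖ := by rw [this]; exact norm_sub_le _ _
        _ = _ := by rw [norm_smul, Real.norm_of_nonneg hsin.le]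
    have h3 : Real.cos θ * p x ≤ t * (‖z‖ + Real.sin θ * ‖y‖) := by
      nlinarith [mul_le_mul_of_nonneg_left hpx.le hcos, mul_le_mul_of_nonneg_left h2 ht.le]
    have h4 : Real.sin θ * p y ≤ Real.sin θ * (‖y‖ * (1 / c)) := by
      refine mul_le_mul_of_nonneg_left ((hle y).trans (le_of_eq (by ring))) hsin.le
    have htc : 0 < t + 1 / c := by positivity
    have h5 : Real.sin θ * (t + 1 / c) * ‖y‖ < Real.sin θ * (t + 1 / c) * (2 * ‖z‖) :=
      mul_lt_mul_of_pos_left hyz (by positivity)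
    have h6 : Real.sin θ * ((t + 1 / c) * (2 * ‖z‖)) ≤ θ * ((t + 1 / c) * (2 * ‖z‖)) :=
      mul_le_mul_of_nonneg_right (Real.sin_le hθ0.le) (by positivity)
    change p z < (t + 2 * θ * (t + 1 / c)) * ‖z‖
    linarith
  have hrot := measurePreserving_rotation_stdGaussian (E := EuclideanSpace ℝ (Fin n)) θ
  have hfst := measurePreserving_fst (μ := γ) (ν := γ)
  have hsnd := measurePreserving_snd (μ := γ) (ν := γ)
  refine (measureReal_mono hsub).trans ((measureReal_union_le _ _).trans ?_)
  have h7 := measureReal_union_le (μ := γ.prod γ) (Prod.snd ⁻¹' bad)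
    (ContinuousLinearMap.rotation θ ⁻¹' (Prod.fst ⁻¹' bad))
  rw [hrot.measureReal_preimage (measurable_fst hbadm).nullMeasurableSet,
    hfst.measureReal_preimage hbadm.nullMeasurableSet,
    hsnd.measureReal_preimage hbadm.nullMeasurableSet] at h7
  rw [hrot.measureReal_preimage (measurable_fst hdm).nullMeasurableSet,
    hfst.measureReal_preimage hdm.nullMeasurableSet,
    measureReal_sdiff (sublevelCone_mono htt') (hCm t)]
  have h8 : (640 : ℝ) / n = 320 / n + 320 / n := by ring
  linarith


lemma stdGaussian_sublevelCone_gap (hn : 10 ^ 15 ≤ n) (hp : Measurable p)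
    (hsmul : ∀ (r : ℝ) x, 0 ≤ r → p (r • x) = r * p x) (hadd : ∀ x y, p (x + y) ≤ p x + p y)
    (hle : ∀ x, p x ≤ ‖x‖ / 10 ^ 6) {r : ℝ} (hr0 : 0 < r)
    (hr : (ProbabilityTheory.stdGaussian (EuclideanSpace ℝ (Fin n))).real
      {x | ‖x‖ ∈ Set.Iic r} = 1 / 2)
    (h : 9 / 100 ≤
      (ProbabilityTheory.stdGaussian (EuclideanSpace ℝ (Fin n))).real (sublevelCone p r⁻¹) *
      (1 - (ProbabilityTheory.stdGaussian (EuclideanSpace ℝ (Fin n))).real (sublevelCone p r⁻¹))) :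
    1 / n ≤ (ProbabilityTheory.stdGaussian (EuclideanSpace ℝ (Fin n))).real
        (sublevelCone p ((1 - 1 / √n) * r)⁻¹) -
      (ProbabilityTheory.stdGaussian (EuclideanSpace ℝ (Fin n))).real (sublevelCone p r⁻¹) := by
  have hn' : (10 ^ 15 : ℝ) ≤ n := by exact_mod_cast hn
  have hrq := le_two_mul_sqrt_of_stdGaussian_closedBall (by omega) hr
  have hsq : √(n : ℝ) ^ 2 = n := Real.sq_sqrt (by positivity)
  set q := √(n : ℝ) with hq
  have hq1 : 10 ^ 6 ≤ q := Real.le_sqrt_of_sq_le (by linarith)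
  set s : ℝ := 1 / q with hs
  have hs0 : 0 < s := by positivity
  have hsq1 : s * q = 1 := by rw [hs]; field_simp
  have hs1 : s ≤ 1 / 10 ^ 6 := one_div_le_one_div_of_le (by positivity) hq1
  set N := n / 10 ^ 4 with hN
  have hN1 : (N : ℝ) ≤ n / 10 ^ 4 := by
    have : N * 10 ^ 4 ≤ n := Nat.div_mul_le_self _ _
    rw [le_div_iff₀ (by positivity)]
    exact_mod_cast this
  have hN2 : (n : ℝ) / (2 * 10 ^ 4) ≤ N := by
    have : n ≤ N * (2 * 10 ^ 4) := by omega
    rw [div_le_iff₀ (by positivity)]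
    exact_mod_cast this
  have hN0 : (0 : ℝ) < N := lt_of_lt_of_le (by positivity) hN2
  have key := stdGaussian_sublevelCone_increment (by omega) (by positivity) hp hsmul hadd hle
    (inv_pos.2 hr0) (Nat.cast_ne_zero.1 hN0.ne')
  have hθ : 2 * (Real.pi / (2 * N)) ≤ 8 * 10 ^ 4 * s ^ 2 := by
    have h1 : 2 * (Real.pi / (2 * N)) = Real.pi / N := by field_simp
    have h2 : s ^ 2 * n = 1 := by rw [← hsq, ← mul_pow, hsq1, one_pow]
    rw [h1, div_le_iff₀ hN0]
    have := mul_le_mul_of_nonneg_left hN2 (sq_nonneg s)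
    linarith [Real.pi_le_four]
  have ht : r⁻¹ + 2 * (Real.pi / (2 * N)) * (r⁻¹ + 1 / 10 ^ 6) ≤ ((1 - s) * r)⁻¹ := by
    have h1 : r⁻¹ + 1 / 10 ^ 6 = r⁻¹ * (1 + r / 10 ^ 6) := by field_simp
    have h2 : (1 + s) * r⁻¹ ≤ ((1 - s) * r)⁻¹ := by
      rw [mul_inv]
      refine mul_le_mul_of_nonneg_right ?_ (by positivity)
      rw [← one_div, le_div_iff₀ (by linarith)]
      nlinarith
    have h3 : 2 * (Real.pi / (2 * N)) * (1 + r / 10 ^ 6) ≤ s := by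
      calc _ ≤ 8 * 10 ^ 4 * s ^ 2 * (1 + 2 * q / 10 ^ 6) := by gcongr
        _ = 8 * 10 ^ 4 * s ^ 2 + 16 / 100 * s * (s * q) := by ring
        _ ≤ s := by rw [hsq1]; nlinarith
    rw [h1]
    refine le_trans (le_of_eq ?_)
      ((mul_le_mul_of_nonneg_right (add_le_add_right h3 1) (inv_pos.2 hr0).le).trans h2)
    ring
  have hmono := measureReal_mono
    (μ := ProbabilityTheory.stdGaussian (EuclideanSpace ℝ (Fin n))) (sublevelCone_mono (p := p) ht)
  have hpos := measureReal_mono (μ := ProbabilityTheory.stdGaussian (EuclideanSpace ℝ (Fin n)))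
    (sublevelCone_mono (p := p) (le_add_of_nonneg_right (a := r⁻¹) (by
      have := Real.pi_pos
      positivity : 0 ≤ 2 * (Real.pi / (2 * (N : ℝ))) * (r⁻¹ + 1 / 10 ^ 6))))
  have h4 := mul_le_mul_of_nonneg_right hN1
    (add_nonneg (sub_nonneg.2 hpos) (by positivity : (0 : ℝ) ≤ 640 / n))
  have h5 := (h.trans key).trans h4
  rw [div_mul_eq_mul_div, mul_add, mul_div_cancel₀ _ (by positivity : (n : ℝ) ≠ 0)] at h5
  rw [div_le_iff₀ (by positivity)]
  have h6 := mul_le_mul_of_nonneg_right hmono (by positivity : (0 : ℝ) ≤ n)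
  linarith

lemma stdGaussian_real_norm_inter_sublevelCone [NeZero n] (hp : Measurable p)
    (hsmul : ∀ (r : ℝ) x, 0 ≤ r → p (r • x) = r * p x) {s : Set ℝ} (hs : MeasurableSet s)
    (t : ℝ) :
    (ProbabilityTheory.stdGaussian (EuclideanSpace ℝ (Fin n))).real
      ({x | ‖x‖ ∈ s} ∩ sublevelCone p t) =
    (ProbabilityTheory.stdGaussian (EuclideanSpace ℝ (Fin n))).real {x | ‖x‖ ∈ s} *
      (ProbabilityTheory.stdGaussian (EuclideanSpace ℝ (Fin n))).real (sublevelCone p t) := by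
  have : Nonempty (Fin n) := ⟨0⟩
  rw [measureReal_def, stdGaussian_norm_inter_cone (measurableSet_sublevelCone hp t)
    (fun r x hr ↦ smul_mem_sublevelCone_iff hsmul t r x hr) hs, ENNReal.toReal_mul]
  rfl

/-- The centered ball of median radius captures noticeably more of a sublevel set of roughly half
the mass than its complement does. -/
lemma exp_div_le_stdGaussian_sublevel_inter_closedBall_sub (hn : 10 ^ 15 ≤ n) (hp : Measurable p)
    (hsmul : ∀ (r : ℝ) x, 0 ≤ r → p (r • x) = r * p x) (hadd : ∀ x y, p (x + y) ≤ p x + p y)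
    (hle : ∀ x, p x ≤ ‖x‖ / 10 ^ 6) {r : ℝ} (hr0 : 0 < r)
    (hr : (ProbabilityTheory.stdGaussian (EuclideanSpace ℝ (Fin n))).real
      {x | ‖x‖ ∈ Set.Iic r} = 1 / 2)
    (hvol : |(ProbabilityTheory.stdGaussian (EuclideanSpace ℝ (Fin n))).real {x | p x < 1} - 1 / 2|
      ≤ 1 / 20) :
    Real.exp (-23) / 4 / n ≤
      (ProbabilityTheory.stdGaussian (EuclideanSpace ℝ (Fin n))).real
        ({x | p x < 1} ∩ {x | ‖x‖ ∈ Set.Iic r}) -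
      (ProbabilityTheory.stdGaussian (EuclideanSpace ℝ (Fin n))).real
        ({x | p x < 1} \ {x | ‖x‖ ∈ Set.Iic r}) := by
  have hn' : (10 ^ 15 : ℝ) ≤ n := by exact_mod_cast hn
  have : NeZero n := ⟨by omega⟩
  have hF1 := exp_le_stdGaussian_closedBall_sub (by omega) hr
  have hgap := stdGaussian_sublevelCone_gap hn hp hsmul hadd hle hr0 hr
  set γ := ProbabilityTheory.stdGaussian (EuclideanSpace ℝ (Fin n))
  set s : ℝ := 1 / √n
  have hs0 : 0 < s := by positivity
  have hs1 : s < 1 := by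
    rw [div_lt_one (by positivity)]
    exact Real.lt_sqrt_of_sq_lt (by linarith)
  set a₀ := γ.real (sublevelCone p r⁻¹)
  set a₁ := γ.real (sublevelCone p ((1 - s) * r)⁻¹)
  set F := γ.real {x | ‖x‖ ∈ Set.Iic ((1 - s) * r)}
  have hr1 : 0 < (1 - s) * r := mul_pos (by linarith) hr0
  have hr1r : (1 - s) * r ≤ r := by nlinarith
  have hcone : ∀ {ρ : ℝ}, 0 < ρ → ∀ {x}, x ∈ sublevelCone p ρ⁻¹ → ‖x‖ ≤ ρ → p x < 1 := by
    intro ρ hρ x hx hxρ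
    refine lt_of_lt_of_le hx ?_
    rw [inv_mul_le_iff₀ hρ, mul_one]
    exact hxρ
  have hBm : MeasurableSet {x : EuclideanSpace ℝ (Fin n) | ‖x‖ ∈ Set.Iic r} :=
    measurable_norm measurableSet_Iic
  have hB1m : MeasurableSet {x : EuclideanSpace ℝ (Fin n) | ‖x‖ ∈ Set.Iic ((1 - s) * r)} :=
    measurable_norm measurableSet_Iic
  have hshell : γ.real {x | ‖x‖ ∈ Set.Ioc ((1 - s) * r) r} = 1 / 2 - F := by
    have hsub : {x : EuclideanSpace ℝ (Fin n) | ‖x‖ ∈ Set.Iic ((1 - s) * r)} ⊆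
        {x | ‖x‖ ∈ Set.Iic r} := fun x hx ↦ le_trans hx hr1r
    rw [← hr, ← measureReal_sdiff hsub hB1m]
    congr 1
    ext x
    simp [and_comm]
  have hcompl : γ.real {x | ‖x‖ ∈ Set.Ioi r} = 1 / 2 := by
    have := probReal_compl_eq_one_sub (μ := γ) hBm
    rw [hr] at this
    rw [← Set.compl_Iic]
    exact this.trans (by norm_num)
  have hin : F * a₁ + (1 / 2 - F) * a₀ ≤ γ.real ({x | p x < 1} ∩ {x | ‖x‖ ∈ Set.Iic r}) := by
    rw [← hshell, ← stdGaussian_real_norm_inter_sublevelCone hp hsmul measurableSet_Iic,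
      ← stdGaussian_real_norm_inter_sublevelCone hp hsmul measurableSet_Ioc,
      ← measureReal_union]
    · refine measureReal_mono ?_
      rintro x (⟨hx, hxC⟩ | ⟨hx, hxC⟩)
      · exact ⟨hcone hr1 hxC hx, le_trans hx hr1r⟩
      · exact ⟨hcone hr0 hxC hx.2, hx.2⟩
    · exact Set.disjoint_left.2 fun x hx hx' ↦ not_le.2 hx'.1.1 hx.1
    · exact (measurable_norm measurableSet_Ioc).inter (measurableSet_sublevelCone hp _)
  have hout : γ.real ({x | p x < 1} \ {x | ‖x‖ ∈ Set.Iic r}) ≤ 1 / 2 * a₀ := by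
    rw [← hcompl, ← stdGaussian_real_norm_inter_sublevelCone hp hsmul measurableSet_Ioi]
    refine measureReal_mono ?_
    rintro x ⟨hx, hxr⟩
    have hxr' : r < ‖x‖ := not_le.1 hxr
    refine ⟨hxr', lt_of_lt_of_le (show p x < 1 from hx) ?_⟩
    rw [← div_eq_inv_mul, le_div_iff₀ hr0, one_mul]
    exact hxr'.le
  have hsum := measureReal_inter_add_sdiff (μ := γ) (s := {x | p x < 1}) hBm
  rw [abs_le] at hvol
  have ha₀ : 0 ≤ a₀ := measureReal_nonneg
  have ha : a₀ ≤ a₁ := measureReal_mono (sublevelCone_mono (inv_anti₀ hr1 hr1r))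
  have hF0 : 0 ≤ F := measureReal_nonneg
  have hFa : 0 ≤ F * (a₁ - a₀) := mul_nonneg hF0 (by linarith)
  have hsmall : Real.exp (-23) / 4 / n ≤ 35 / 100 := by
    have : Real.exp (-23) ≤ 1 := Real.exp_le_one_iff.2 (by norm_num)
    rw [div_le_iff₀ (by positivity)]
    linarith
  rcases lt_or_ge a₀ (1 / 10) with h1 | h1
  · linarith
  rcases lt_or_ge (9 / 10) a₀ with h2 | h2
  · linarith
  have h3 := hgap (by nlinarith)
  have h4 : Real.exp (-23) / 4 / n ≤ F * (a₁ - a₀) := by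
    rw [div_eq_mul_one_div _ (n : ℝ)]
    exact mul_le_mul hF1 h3 (by positivity) hF0
  linarith

end Sublinear

lemma stdGaussian_eq_stdGaussian_euclideanSpace (n : ℕ) :
    stdGaussian n = ProbabilityTheory.stdGaussian (EuclideanSpace ℝ (Fin n)) :=
  map_pi_eq_stdGaussian

lemma setOf_ite_eq_pmInd_ae_eq {n : ℕ} {K G : Set (EuclideanSpace ℝ (Fin n))}
    {μ : Measure (EuclideanSpace ℝ (Fin n))} (h : G =ᵐ[μ] K) (r : ℝ) :
    {x | (if ‖x‖ ≤ r then (1 : ℝ) else -1) = pmInd K x} =ᵐ[μ]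
      ((G ∩ {x | ‖x‖ ∈ Set.Iic r}) ∪ ({x | ‖x‖ ∈ Set.Iic r}ᶜ \ G) :
        Set (EuclideanSpace ℝ (Fin n))) := by
  filter_upwards [h.mem_iff] with x hx
  refine propext ?_
  change ((if ‖x‖ ≤ r then (1 : ℝ) else -1) = pmInd K x) ↔
    x ∈ (G ∩ {x | ‖x‖ ∈ Set.Iic r}) ∪ ({x | ‖x‖ ∈ Set.Iic r}ᶜ \ G)
  by_cases h1 : ‖x‖ ≤ r <;> by_cases h2 : x ∈ K <;>
    simp [pmInd, h1, h2, hx] <;> norm_num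

/-- If `K` is a convex set whose Gaussian volume is within `c·n^{-1/2}` of `1/2`
and which contains the ball `B(0ⁿ, c)`, then the origin-centered ball of radius
`r_median` agrees with `K` with probability at least `1/2 + c'/n`. -/
theorem ball_hypothesis_weak_learner_general :
    ∃ c c' : ℝ, 0 < c ∧ 0 < c' ∧ ∃ n₀ : ℕ, ∀ n : ℕ, n₀ ≤ n →
      ∀ K : Set (EuclideanSpace ℝ (Fin n)),
        Convex ℝ K →
        |gaussVol n K - 1 / 2| ≤ c / Real.sqrt n →
        Metric.closedBall (0 : EuclideanSpace ℝ (Fin n)) c ⊆ K →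
        ∀ rmedian : ℝ, 0 < rmedian →
          stdGaussian n (Metric.closedBall (0 : EuclideanSpace ℝ (Fin n)) rmedian)
            = 1 / 2 →
          1 / 2 + c' / (n : ℝ) ≤
            (stdGaussian n
              {x | (if ‖x‖ ≤ rmedian then (1 : ℝ) else -1) = pmInd K x}).toReal := by
  refine ⟨10 ^ 6, Real.exp (-23) / 4, by norm_num, by positivity, 10 ^ 15, ?_⟩
  intro n hn K hK hvol hball r hr0 hr
  have hn' : (10 ^ 15 : ℝ) ≤ n := by exact_mod_cast hn
  rw [gaussVol, stdGaussian_eq_stdGaussian_euclideanSpace] at hvol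
  rw [stdGaussian_eq_stdGaussian_euclideanSpace] at hr ⊢
  set γ := ProbabilityTheory.stdGaussian (EuclideanSpace ℝ (Fin n))
  set B : Set (EuclideanSpace ℝ (Fin n)) := {x | ‖x‖ ∈ Set.Iic r} with hB
  have hBm : MeasurableSet B := measurable_norm measurableSet_Iic
  have hBr : γ.real B = 1 / 2 := by
    have : B = Metric.closedBall 0 r := by ext; simp [hB]
    rw [this, measureReal_def, hr]
    simp
  have hK0 : K ∈ nhds 0 := Filter.mem_of_superset (Metric.closedBall_mem_nhds 0 (by norm_num)) hball
  have hcont : Continuous (gauge K) := continuous_gauge hK hK0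
  set G : Set (EuclideanSpace ℝ (Fin n)) := {x | gauge K x < 1} with hG
  have hGm : MeasurableSet G := measurableSet_lt hcont.measurable measurable_const
  have hGK : G =ᵐ[γ] K := by
    rw [hG, setOfPred_gauge_lt_one_eq_interior hK hK0]
    exact interior_ae_eq_of_null_frontier
      (stdGaussian_absolutelyContinuous (hK.addHaar_frontier volume))
  have hq : 10 ^ 6 / √(n : ℝ) ≤ 1 / 20 := by
    have : 20 * 10 ^ 6 ≤ √(n : ℝ) := Real.le_sqrt_of_sq_le (by linarith)
    rw [div_le_iff₀ (by linarith)]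
    linarith
  have main := exp_div_le_stdGaussian_sublevel_inter_closedBall_sub hn hcont.measurable
    (fun t x ht ↦ gauge_smul_of_nonneg ht x)
    (gauge_add_le hK (absorbent_nhds_zero hK0))
    (fun x ↦ by
      rw [le_div_iff₀ (by norm_num), mul_comm]
      exact mul_gauge_le_norm (Metric.ball_subset_closedBall.trans hball))
    hr0 hBr (by
      rw [measureReal_congr hGK]
      exact hvol.trans hq)
  rw [← measureReal_def, measureReal_congr (setOf_ite_eq_pmInd_ae_eq hGK r), ← hB,
    measureReal_union
      (Set.disjoint_left.2 fun x hx hx' ↦ hx'.2 hx.1) (hBm.compl.diff hGm)]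
  have h1 := measureReal_inter_add_sdiff (μ := γ) (s := Bᶜ) hGm
  have h2 : Bᶜ ∩ G = G \ B := by rw [Set.inter_comm, Set.sdiff_eq]
  rw [h2, probReal_compl_eq_one_sub hBm, hBr] at h1
  linarith
end

section
/- There exist absolute constants c > 0, c' > 0 and n₀ ∈ ℕ such that for all n ≥ n₀ the following holds. Let K ⊆ ℝⁿ be a centrally symmetric convex set with |vol(K) − 1/2| ≤ c, and let r* > 0 be such that α_K(r*) = vol(K). Then E_{g ∼ N(0,1)ⁿ}[(1_K(g) − vol(K)) · ((r*)² − ‖g‖₂²)] ≥ c', where 1_K is the 0/1-valued indicator function of K. -/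
open MeasureTheory ProbabilityTheory

/-- The uniform (rotation-invariant) probability measure on the origin-centered sphere of
radius `r` in `ℝⁿ`. -/
noncomputable def sphereUniform (n : ℕ) (r : ℝ) : Measure (EuclideanSpace ℝ (Fin n)) :=
  (stdGaussian n).map (fun x => (r / ‖x‖) • x)

/-- The shell density `α_K(r)`. -/
noncomputable def shellDensity (n : ℕ) (K : Set (EuclideanSpace ℝ (Fin n))) (r : ℝ) : ℝ :=
  (sphereUniform n r K).toReal

section NormedSpace

variable {E : Type*} [NormedAddCommGroup E] [InnerProductSpace ℝ E]

variable (E) in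
/-- The normalizing constant of the standard Gaussian density. -/
noncomputable def gaussConst : ℝ := ((2 * Real.pi) ^ (Module.finrank ℝ E / 2 : ℝ))⁻¹

lemma gaussConst_pos : 0 < gaussConst E := by
  unfold gaussConst; positivity

lemma opNorm_le_of_lt_one_on_closedBall {f : StrongDual ℝ E} {ρ : ℝ} (hρ : 0 < ρ)
    (hf : ∀ x ∈ Metric.closedBall (0 : E) ρ, f x < 1) : ‖f‖ ≤ ρ⁻¹ := by
  have key : ∀ x, f x ≤ ρ⁻¹ * ‖x‖ := by
    intro x
    rcases eq_or_ne x 0 with rfl | hx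
    · simp
    have hx' : 0 < ‖x‖ := norm_pos_iff.2 hx
    have h := hf ((ρ / ‖x‖) • x) (by
      rw [mem_closedBall_zero_iff, norm_smul, norm_div, norm_norm, Real.norm_of_nonneg hρ.le,
        div_mul_cancel₀ _ hx'.ne'])
    rw [map_smul, smul_eq_mul, div_mul_eq_mul_div, div_lt_one hx'] at h
    rw [inv_mul_eq_div, le_div_iff₀ hρ]
    linarith
  refine f.opNorm_le_bound (by positivity) fun x => ?_
  rw [Real.norm_eq_abs]
  refine abs_le'.2 ⟨key x, ?_⟩
  simpa using key (-x)

lemma mem_iff_gauge_lt_one {K : Set E} (hK : Convex ℝ K) (hKo : IsOpen K) (hK0 : (0 : E) ∈ K)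
    (x : E) : x ∈ K ↔ gauge K x < 1 :=
  Set.ext_iff.1 (setOfPred_gauge_lt_one_eq_self_of_isOpen hK hK0 hKo).symm x

end NormedSpace

section Gaussian

variable {E : Type*} [NormedAddCommGroup E] [InnerProductSpace ℝ E] [FiniteDimensional ℝ E]
  [MeasurableSpace E] [BorelSpace E]

local notation "γ" => ProbabilityTheory.stdGaussian

lemma integrable_exp_neg_mul_sq_norm {b : ℝ} (hb : 0 < b) :
    Integrable (fun x : E => Real.exp (-b * ‖x‖ ^ 2)) := by
  have h := (GaussianFourier.integrable_cexp_neg_mul_sq_norm_add (V := E) (b := (b : ℂ))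
    (by simpa using hb) 0 0).re
  refine h.congr (ae_of_all _ fun x => ?_)
  have : (-(b : ℂ) * (‖x‖ : ℂ) ^ 2 + 0 * ((inner ℝ (0 : E) x : ℝ) : ℂ))
      = ((-b * ‖x‖ ^ 2 : ℝ) : ℂ) := by push_cast; ring
  simp only [this]
  exact Complex.exp_ofReal_re _

lemma stdGaussian_eq_withDensity_s16 :
    γ E = volume.withDensity
      (fun x => ENNReal.ofReal (gaussConst E * Real.exp (-(1 / 2) * ‖x‖ ^ 2))) := by
  have hint : Integrable (fun x : E => gaussConst E * Real.exp (-(1 / 2) * ‖x‖ ^ 2)) :=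
    (integrable_exp_neg_mul_sq_norm (by norm_num)).const_mul _
  have : IsFiniteMeasure (volume.withDensity
      (fun x : E => ENNReal.ofReal (gaussConst E * Real.exp (-(1 / 2) * ‖x‖ ^ 2)))) :=
    isFiniteMeasure_withDensity_ofReal hint.2
  apply Measure.ext_of_charFun
  ext t
  rw [charFun_stdGaussian, charFun_apply, integral_withDensity_eq_integral_toReal_smul
    (by fun_prop) (by simp)]
  have h := GaussianFourier.integral_cexp_neg_mul_sq_norm_add (V := E) (b := (1 / 2 : ℂ))
    (by norm_num) Complex.I t
  have h2 : ∀ x : E, (ENNReal.ofReal (gaussConst E * Real.exp (-(1 / 2) * ‖x‖ ^ 2))).toReal •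
      Complex.exp (((inner ℝ x t : ℝ) : ℂ) * Complex.I) = (gaussConst E : ℂ) *
      Complex.exp (-(1 / 2) * (‖x‖ : ℂ) ^ 2 + Complex.I * ((inner ℝ t x : ℝ) : ℂ)) := by
    intro x
    rw [ENNReal.toReal_ofReal (by have := gaussConst_pos (E := E); positivity), Complex.exp_add,
      Complex.real_smul, real_inner_comm]
    push_cast
    rw [mul_comm Complex.I]
    ring
  simp_rw [h2]
  rw [integral_const_mul, h]
  have h3 : (gaussConst E : ℂ) * ((Real.pi : ℂ) / (1 / 2)) ^ (Module.finrank ℝ E / 2 : ℂ) = 1 := by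
    have : ((Real.pi : ℂ) / (1 / 2)) ^ (Module.finrank ℝ E / 2 : ℂ)
        = (((2 * Real.pi) ^ (Module.finrank ℝ E / 2 : ℝ) : ℝ) : ℂ) := by
      rw [Complex.ofReal_cpow (by positivity)]
      push_cast
      congr 1
      ring
    rw [this, gaussConst, ← Complex.ofReal_mul, inv_mul_cancel₀ (by positivity)]
    simp
  rw [← mul_assoc, h3, one_mul]
  congr 1
  rw [Complex.I_sq]
  ring

lemma stdGaussian_real_eq_setIntegral {A : Set E} (hA : MeasurableSet A) :
    (γ E).real A = ∫ x in A, gaussConst E * Real.exp (-(1 / 2) * ‖x‖ ^ 2) := by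
  rw [measureReal_def, stdGaussian_eq_withDensity_s16, withDensity_apply _ hA,
    integral_eq_lintegral_of_nonneg_ae]
  · exact ae_of_all _ fun x => by have := gaussConst_pos (E := E); positivity
  · fun_prop

lemma setIntegral_sq_norm_stdGaussian {A : Set E} (hA : MeasurableSet A) :
    ∫ x in A, ‖x‖ ^ 2 ∂(γ E) =
      ∫ x in A, gaussConst E * (‖x‖ ^ 2 * Real.exp (-(1 / 2) * ‖x‖ ^ 2)) := by
  rw [stdGaussian_eq_withDensity_s16, setIntegral_withDensity_eq_setIntegral_toReal_smul
    (by fun_prop) (by simp) _ hA]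
  refine integral_congr_ae (ae_of_all _ fun x => ?_)
  simp only
  rw [ENNReal.toReal_ofReal (by have := gaussConst_pos (E := E); positivity), smul_eq_mul]
  ring

lemma stdGaussian_real_dilate {A : Set E} (hA : MeasurableSet A) {t : ℝ} (ht : 0 < t) :
    (γ E).real {x | t⁻¹ • x ∈ A} = t ^ (Module.finrank ℝ E) *
      ∫ x in A, gaussConst E * Real.exp (-(1 / 2) * t ^ 2 * ‖x‖ ^ 2) := by
  have hset : {x : E | t⁻¹ • x ∈ A} = (fun x : E => t⁻¹ • x) ⁻¹' A := rfl
  rw [stdGaussian_real_eq_setIntegral (by rw [hset]; exact hA.preimage (by fun_prop)),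
    ← integral_indicator (by rw [hset]; exact hA.preimage (by fun_prop)),
    ← integral_indicator hA]
  have h := Measure.integral_comp_smul (volume : Measure E)
    (A.indicator fun x => gaussConst E * Real.exp (-(1 / 2) * t ^ 2 * ‖x‖ ^ 2)) t⁻¹
  have h2 : |((t⁻¹) ^ Module.finrank ℝ E)⁻¹| = t ^ Module.finrank ℝ E := by
    rw [inv_pow, inv_inv, abs_of_pos (by positivity)]
  rw [h2, smul_eq_mul] at h
  rw [← h]
  refine integral_congr_ae (ae_of_all _ fun x => ?_)
  beta_reduce
  by_cases hx : t⁻¹ • x ∈ A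
  · rw [Set.indicator_of_mem (show x ∈ {x : E | t⁻¹ • x ∈ A} from hx), Set.indicator_of_mem hx]
    simp only [norm_smul, Real.norm_eq_abs, mul_pow, sq_abs]
    congr 2
    field_simp
  · rw [Set.indicator_of_notMem (show x ∉ {x : E | t⁻¹ • x ∈ A} from hx),
      Set.indicator_of_notMem hx]

/-- The derivative of the Gaussian measure of the dilates of a measurable set. -/
lemma hasDerivAt_stdGaussian_dilate {A : Set E} (hA : MeasurableSet A) :
    HasDerivAt (fun t : ℝ => (γ E).real {x | t⁻¹ • x ∈ A})
      (Module.finrank ℝ E * (γ E).real A - ∫ x in A, ‖x‖ ^ 2 ∂(γ E)) 1 := by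
  have hc := gaussConst_pos (E := E)
  have key := hasDerivAt_integral_of_dominated_loc_of_deriv_le
    (μ := volume.restrict A) (x₀ := (1 : ℝ)) (s := Set.Ioo (1 / 2) 2)
    (F := fun t x => gaussConst E * Real.exp (-(1 / 2) * t ^ 2 * ‖x‖ ^ 2))
    (F' := fun t x => gaussConst E * (Real.exp (-(1 / 2) * t ^ 2 * ‖x‖ ^ 2) * (-t * ‖x‖ ^ 2)))
    (bound := fun x => gaussConst E * 32 * Real.exp (-(1 / 16) * ‖x‖ ^ 2))
    (Ioo_mem_nhds (by norm_num) (by norm_num))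
    (Filter.Eventually.of_forall fun t => by fun_prop)
    (by
      have := (integrable_exp_neg_mul_sq_norm (E := E) (b := 1 / 2) (by norm_num)).const_mul
        (gaussConst E)
      simpa using this.restrict)
    (by fun_prop)
    (ae_of_all _ fun x t ht => by
      have ht0 : 0 < t := by linarith [ht.1]
      have ht1 : 1 / 4 ≤ t ^ 2 := by nlinarith [ht.1]
      rw [norm_mul, norm_mul, Real.norm_of_nonneg hc.le, Real.norm_of_nonneg (Real.exp_pos _).le,
        norm_mul, norm_neg, Real.norm_of_nonneg ht0.le,
        Real.norm_of_nonneg (by positivity),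
        mul_assoc (gaussConst E)]
      refine mul_le_mul_of_nonneg_left ?_ hc.le
      have e1 : Real.exp (-(1 / 2) * t ^ 2 * ‖x‖ ^ 2) ≤ Real.exp (-(1 / 8) * ‖x‖ ^ 2) := by
        apply Real.exp_le_exp.2
        nlinarith [sq_nonneg ‖x‖]
      have e2 : 1 / 16 * ‖x‖ ^ 2 ≤ Real.exp (1 / 16 * ‖x‖ ^ 2) := by
        linarith [Real.add_one_le_exp (1 / 16 * ‖x‖ ^ 2)]
      calc Real.exp (-(1 / 2) * t ^ 2 * ‖x‖ ^ 2) * (t * ‖x‖ ^ 2)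
          ≤ Real.exp (-(1 / 8) * ‖x‖ ^ 2) * (2 * (16 * Real.exp (1 / 16 * ‖x‖ ^ 2))) := by
            gcongr
            · exact ht.2.le
            · linarith
        _ = 32 * (Real.exp (-(1 / 8) * ‖x‖ ^ 2) * Real.exp (1 / 16 * ‖x‖ ^ 2)) := by ring
        _ = 32 * Real.exp (-(1 / 16) * ‖x‖ ^ 2) := by
            rw [← Real.exp_add]; congr 2; ring)
    ((integrable_exp_neg_mul_sq_norm (by norm_num)).const_mul _).integrableOn
    (ae_of_all _ fun x t _ => by
      apply HasDerivAt.const_mul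
      apply HasDerivAt.exp
      have := (((hasDerivAt_id t).pow 2).const_mul (-(1 / 2))).mul_const (‖x‖ ^ 2)
      convert! this using 1
      simp)
  have h2 := (hasDerivAt_pow (Module.finrank ℝ E) (1 : ℝ)).mul key.2
  have h3 : (fun t : ℝ => (γ E).real {x | t⁻¹ • x ∈ A}) =ᶠ[nhds 1]
      ((fun t : ℝ => t ^ Module.finrank ℝ E) * fun t : ℝ =>
        ∫ x in A, gaussConst E * Real.exp (-(1 / 2) * t ^ 2 * ‖x‖ ^ 2)) := by
    filter_upwards [lt_mem_nhds (zero_lt_one : (0 : ℝ) < 1)] with t ht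
    simpa using stdGaussian_real_dilate hA ht
  refine (h2.congr_of_eventuallyEq h3).congr_deriv ?_
  rw [setIntegral_sq_norm_stdGaussian hA, stdGaussian_real_eq_setIntegral hA]
  simp only [one_pow, mul_one, one_mul, sub_eq_add_neg, ← integral_neg]
  congr 2
  ext x
  ring

lemma integrable_sq_norm_stdGaussian : Integrable (fun x : E => ‖x‖ ^ 2) (γ E) := by
  have := (IsGaussian.memLp_two_id (μ := γ E)).norm.integrable_sq
  simpa using this

lemma integral_sq_norm_stdGaussian : ∫ x, ‖x‖ ^ 2 ∂(γ E) = Module.finrank ℝ E := by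
  have h := hasDerivAt_stdGaussian_dilate (E := E) MeasurableSet.univ
  have h2 : HasDerivAt (fun t : ℝ => (γ E).real {x | t⁻¹ • x ∈ Set.univ}) 0 1 := by
    simpa using hasDerivAt_const (1 : ℝ) (1 : ℝ)
  have := h.unique h2
  simp at this
  linarith

lemma map_dual_stdGaussian (L : StrongDual ℝ E) :
    (γ E).map L = (gaussianReal 0 1).map (‖L‖ * ·) := by
  rw [IsGaussian.map_eq_gaussianReal, gaussianReal_map_const_mul, integral_strongDual_stdGaussian,
    variance_dual_stdGaussian]
  congr 1
  · simp
  · ext; simp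

lemma stdGaussian_dual_preimage (L : StrongDual ℝ E) {B : Set ℝ} (hB : MeasurableSet B) :
    γ E {x | L x ∈ B} = gaussianReal 0 1 {τ | ‖L‖ * τ ∈ B} := by
  have h1 : γ E {x | L x ∈ B} = (γ E).map L B :=
    (Measure.map_apply L.continuous.measurable hB).symm
  rw [h1, map_dual_stdGaussian, Measure.map_apply (by fun_prop) hB]
  rfl

lemma gaussianReal_real_abs_lt_le {ρ : ℝ} (hρ : 0 ≤ ρ) :
    (gaussianReal 0 1).real {τ | |τ| < ρ} ≤ ρ := by
  have hset : {τ : ℝ | |τ| < ρ} = Set.Ioo (-ρ) ρ := by ext; simp [abs_lt]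
  have hnn : 0 ≤ ∫ x in Set.Ioo (-ρ) ρ, gaussianPDFReal 0 1 x :=
    integral_nonneg fun x => gaussianPDFReal_nonneg 0 1 x
  rw [hset, measureReal_def, gaussianReal_apply_eq_integral _ one_ne_zero,
    ENNReal.toReal_ofReal hnn]
  have hpdf : ∀ x, gaussianPDFReal 0 1 x ≤ 1 / 2 := by
    intro x
    rw [gaussianPDFReal_def]
    have h2 : (2 : ℝ) ≤ √(2 * Real.pi * (1 : NNReal)) := by
      apply Real.le_sqrt_of_sq_le
      have := Real.pi_gt_three
      simp only [NNReal.coe_one]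
      linarith
    have h3 : (√(2 * Real.pi * (1 : NNReal)))⁻¹ ≤ 1 / 2 := by
      rw [one_div]; exact inv_anti₀ (by norm_num) h2
    have h4 : Real.exp (-(x - 0) ^ 2 / (2 * (1 : NNReal))) ≤ 1 := by
      apply Real.exp_le_one_iff.2
      have : 0 ≤ (x - 0) ^ 2 / (2 * ((1 : NNReal) : ℝ)) := by positivity
      rw [neg_div]; linarith
    calc _ ≤ (1 / 2 : ℝ) * 1 := mul_le_mul h3 h4 (Real.exp_pos _).le (by norm_num)
      _ = 1 / 2 := by norm_num
  calc ∫ x in Set.Ioo (-ρ) ρ, gaussianPDFReal 0 1 x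
      ≤ ∫ x in Set.Ioo (-ρ) ρ, (1 / 2 : ℝ) := by
        apply integral_mono (integrable_gaussianPDFReal 0 1).restrict
        · exact integrable_const _
        · exact hpdf
    _ = ρ := by
        simp
        rw [max_eq_left] <;> linarith

/-- A symmetric open convex set of Gaussian measure larger than `ρ` contains the closed ball of
radius `ρ`. -/
lemma closedBall_subset_of_lt_stdGaussian {K : Set E} (hK : Convex ℝ K) (hKo : IsOpen K)
    (hK0 : (0 : E) ∈ K) (hKs : ∀ x ∈ K, -x ∈ K) {ρ : ℝ} (hv : ρ < (γ E).real K) :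
    Metric.closedBall 0 ρ ⊆ K := by
  intro x hx
  by_contra hxK
  rw [mem_closedBall_zero_iff] at hx
  have hρ : 0 ≤ ρ := (norm_nonneg x).trans hx
  obtain ⟨f, hfx, hf⟩ := separate_convex_open_set hK0 hK hKo hxK
  have hsub : K ⊆ {y | f y ∈ {s : ℝ | |s| < 1}} := fun y hy => by
    have h1 := hf y hy
    have h2 := hf (-y) (hKs y hy)
    rw [map_neg] at h2
    exact abs_lt.2 ⟨by linarith, h1⟩
  have hfn : 1 ≤ ‖f‖ * ρ := by
    have h1 := f.le_opNorm x
    rw [hfx, norm_one] at h1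
    exact h1.trans (by gcongr)
  have hle : (γ E).real K ≤ (gaussianReal 0 1).real {τ | |τ| < ρ} := by
    refine (measureReal_mono hsub).trans ?_
    rw [measureReal_def, stdGaussian_dual_preimage f
      (measurableSet_lt (by fun_prop) measurable_const), ← measureReal_def]
    refine measureReal_mono fun τ hτ => ?_
    simp only [Set.mem_ofPred_eq, abs_mul, abs_norm] at hτ ⊢
    by_contra! hcon
    have : ‖f‖ * ρ ≤ ‖f‖ * |τ| := by gcongr
    linarith
  linarith [gaussianReal_real_abs_lt_le hρ]

/-- The probability that the rotation by angle `θ` of an independent pair of Gaussian vectors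
moves the first vector out of `K`. -/
noncomputable def exitProb (K : Set E) (θ : ℝ) : ℝ :=
  ((γ E).prod (γ E)).real {p | p.1 ∈ K ∧ Real.cos θ • p.1 + Real.sin θ • p.2 ∉ K}

lemma stdGaussian_prod_rotation (θ : ℝ) {S : Set (E × E)} (hS : MeasurableSet S) :
    ((γ E).prod (γ E)).real {p | (Real.cos θ • p.1 + Real.sin θ • p.2,
      -Real.sin θ • p.1 + Real.cos θ • p.2) ∈ S} = ((γ E).prod (γ E)).real S := by
  have h := IsGaussian.map_rotation_eq_self_of_forall_strongDual_eq_zero (μ := γ E)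
    (fun L => integral_strongDual_stdGaussian L) θ
  conv_rhs => rw [← h]
  rw [measureReal_def, measureReal_def, Measure.map_apply (by fun_prop) hS]
  rfl

lemma measurableSet_exit {K : Set E} (hK : MeasurableSet K) (θ : ℝ) :
    MeasurableSet {p : E × E | p.1 ∈ K ∧ Real.cos θ • p.1 + Real.sin θ • p.2 ∉ K} :=
  (hK.preimage measurable_fst).inter
    (hK.preimage (f := fun p : E × E => Real.cos θ • p.1 + Real.sin θ • p.2) (by fun_prop)).compl

lemma exitProb_add_le {K : Set E} (hK : MeasurableSet K) (θ φ : ℝ) :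
    exitProb K (θ + φ) ≤ exitProb K θ + exitProb K φ := by
  unfold exitProb
  rw [← stdGaussian_prod_rotation θ (measurableSet_exit hK φ)]
  refine le_trans (measureReal_mono ?_) (measureReal_union_le _ _)
  rintro ⟨x, y⟩ ⟨h1, h2⟩
  by_cases h : Real.cos θ • x + Real.sin θ • y ∈ K
  · right
    refine ⟨h, ?_⟩
    convert h2 using 2
    simp only [Real.cos_add, Real.sin_add]
    module
  · exact Or.inl ⟨h1, h⟩

lemma exitProb_nat_mul_le {K : Set E} (hK : MeasurableSet K) (θ : ℝ) (N : ℕ) :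
    exitProb K (N * θ) ≤ N * exitProb K θ := by
  induction N with
  | zero => simp [exitProb]
  | succ N ih =>
    have := exitProb_add_le hK (N * θ) θ
    push_cast
    rw [add_mul, add_mul, one_mul, one_mul]
    linarith

lemma exitProb_pi_div_two {K : Set E} (hK : MeasurableSet K) :
    exitProb K (Real.pi / 2) = (γ E).real K * (1 - (γ E).real K) := by
  have : {p : E × E | p.1 ∈ K ∧ Real.cos (Real.pi / 2) • p.1 + Real.sin (Real.pi / 2) • p.2 ∉ K}
      = K ×ˢ Kᶜ := by
    ext p; simp
  rw [exitProb, this, measureReal_prod_prod, probReal_compl_eq_one_sub hK]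

/-- The factor by which an open convex set containing the ball of radius `ρ` has to be dilated to
account for a rotation by angle `θ` and a Gaussian displacement of size `τ`. -/
noncomputable def dilationFactor (ρ θ τ : ℝ) : ℝ :=
  (1 + Real.sin θ * (ρ⁻¹ * |τ|)) / Real.cos θ

lemma one_le_dilationFactor {ρ θ : ℝ} (hρ : 0 < ρ) (hs : 0 < Real.sin θ) (hc : 0 < Real.cos θ)
    (τ : ℝ) : 1 ≤ dilationFactor ρ θ τ := by
  rw [dilationFactor, le_div_iff₀ hc]
  have : 0 ≤ Real.sin θ * (ρ⁻¹ * |τ|) := by positivity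
  linarith [Real.cos_le_one θ]

lemma stdGaussian_exit_le {K : Set E} (hK : Convex ℝ K) (hKo : IsOpen K) {ρ : ℝ} (hρ : 0 < ρ)
    (hKρ : Metric.closedBall 0 ρ ⊆ K) {θ : ℝ} (hs : 0 < Real.sin θ) (hc : 0 < Real.cos θ)
    {z : E} (hz : z ∉ K) :
    γ E {w | Real.cos θ • z - Real.sin θ • w ∈ K} ≤
      gaussianReal 0 1 {τ | (dilationFactor ρ θ τ)⁻¹ • z ∈ K} := by
  have hK0 : (0 : E) ∈ K := hKρ (by simp [hρ.le])
  have hg : 1 ≤ gauge K z := not_lt.1 fun h => hz ((mem_iff_gauge_lt_one hK hKo hK0 z).2 h)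
  have hg0 : 0 < gauge K z := by linarith
  have hz' : (gauge K z)⁻¹ • z ∉ K := fun h => by
    rw [mem_iff_gauge_lt_one hK hKo hK0, gauge_smul_of_nonneg (by positivity), smul_eq_mul,
      inv_mul_cancel₀ hg0.ne'] at h
    exact lt_irrefl _ h
  obtain ⟨f, hfz, hf⟩ := separate_convex_open_set hK0 hK hKo hz'
  have hfn : ‖f‖ ≤ ρ⁻¹ := opNorm_le_of_lt_one_on_closedBall hρ fun x hx => hf x (hKρ hx)
  have hfz' : f z = gauge K z := by
    rw [map_smul, smul_eq_mul, inv_mul_eq_div, div_eq_one_iff_eq hg0.ne'] at hfz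
    exact hfz
  have hsub : {w | Real.cos θ • z - Real.sin θ • w ∈ K} ⊆
      {w | f w ∈ {r : ℝ | Real.cos θ * gauge K z - Real.sin θ * r < 1}} := fun w hw => by
    have := hf _ hw
    rw [map_sub, map_smul, map_smul, hfz'] at this
    exact this
  refine (measure_mono hsub).trans ?_
  rw [stdGaussian_dual_preimage f (measurableSet_lt (by fun_prop) measurable_const)]
  refine measure_mono fun τ hτ => ?_
  have hT := one_le_dilationFactor hρ hs hc τ
  simp only [Set.mem_ofPred_eq] at hτ ⊢
  rw [mem_iff_gauge_lt_one hK hKo hK0, gauge_smul_of_nonneg (by positivity), smul_eq_mul,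
    inv_mul_eq_div, div_lt_one (by positivity), dilationFactor, lt_div_iff₀ hc]
  have h1 : ‖f‖ * τ ≤ ρ⁻¹ * |τ| :=
    (mul_le_mul_of_nonneg_left (le_abs_self τ) (norm_nonneg f)).trans
      (mul_le_mul_of_nonneg_right hfn (abs_nonneg τ))
  have h2 := mul_le_mul_of_nonneg_left h1 hs.le
  linarith

lemma exitProb_le_integral {K : Set E} (hK : Convex ℝ K) (hKo : IsOpen K) {ρ : ℝ} (hρ : 0 < ρ)
    (hKρ : Metric.closedBall 0 ρ ⊆ K) {θ : ℝ} (hs : 0 < Real.sin θ) (hc : 0 < Real.cos θ) :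
    exitProb K θ ≤
      ∫ τ, ((γ E).real {x | (dilationFactor ρ θ τ)⁻¹ • x ∈ K} - (γ E).real K)
        ∂(gaussianReal 0 1) := by
  have hKm := hKo.measurableSet
  have hK0 : (0 : E) ∈ K := hKρ (by simp [hρ.le])
  have hSm : MeasurableSet {p : E × E | Real.cos θ • p.1 - Real.sin θ • p.2 ∈ K ∧ p.1 ∉ K} :=
    (hKm.preimage (f := fun p : E × E => Real.cos θ • p.1 - Real.sin θ • p.2)
      (by fun_prop)).inter (hKm.preimage measurable_fst).compl
  have hBm : MeasurableSet {p : E × ℝ | (dilationFactor ρ θ p.2)⁻¹ • p.1 ∈ K ∧ p.1 ∉ K} :=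
    (hKm.preimage (f := fun p : E × ℝ => (dilationFactor ρ θ p.2)⁻¹ • p.1)
      (by unfold dilationFactor; fun_prop)).inter (hKm.preimage measurable_fst).compl
  have h1 : exitProb K θ = ((γ E).prod (γ E)).real
      {p : E × E | Real.cos θ • p.1 - Real.sin θ • p.2 ∈ K ∧ p.1 ∉ K} := by
    rw [← stdGaussian_prod_rotation θ hSm, exitProb]
    congr 1
    ext ⟨x, y⟩
    have : Real.cos θ • (Real.cos θ • x + Real.sin θ • y) -
        Real.sin θ • (-Real.sin θ • x + Real.cos θ • y) = x := by
      have : Real.cos θ • (Real.cos θ • x + Real.sin θ • y) -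
        Real.sin θ • (-Real.sin θ • x + Real.cos θ • y) =
        (Real.cos θ ^ 2 + Real.sin θ ^ 2) • x := by module
      rw [this, Real.cos_sq_add_sin_sq, one_smul]
    simp only [Set.mem_ofPred_eq, this]
  have h2 : ((γ E).prod (γ E)) {p : E × E | Real.cos θ • p.1 - Real.sin θ • p.2 ∈ K ∧ p.1 ∉ K} ≤
      ((γ E).prod (gaussianReal 0 1))
        {p : E × ℝ | (dilationFactor ρ θ p.2)⁻¹ • p.1 ∈ K ∧ p.1 ∉ K} := by
    rw [Measure.prod_apply hSm, Measure.prod_apply hBm]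
    refine lintegral_mono fun z => ?_
    by_cases hz : z ∈ K
    · simp [hz]
    · simpa [hz] using stdGaussian_exit_le hK hKo hρ hKρ hs hc hz
  have h3 : ((γ E).prod (gaussianReal 0 1)).real
        {p : E × ℝ | (dilationFactor ρ θ p.2)⁻¹ • p.1 ∈ K ∧ p.1 ∉ K} =
      ∫ τ, ((γ E).real {x | (dilationFactor ρ θ τ)⁻¹ • x ∈ K} - (γ E).real K)
        ∂(gaussianReal 0 1) := by
    rw [measureReal_def, Measure.prod_apply_symm hBm, ← integral_toReal
      (measurable_measure_prodMk_right hBm).aemeasurable (ae_of_all _ fun _ => measure_lt_top _ _)]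
    refine integral_congr_ae (ae_of_all _ fun τ => ?_)
    have hT := one_le_dilationFactor hρ hs hc τ
    have hsub : K ⊆ {x | (dilationFactor ρ θ τ)⁻¹ • x ∈ K} := fun x hx =>
      hK.smul_mem_of_zero_mem hK0 hx ⟨by positivity, inv_le_one_of_one_le₀ hT⟩
    have := measureReal_sdiff (μ := γ E) hsub hKm
    beta_reduce
    rw [← this]
    rfl
  rw [h1, ← h3]
  exact ENNReal.toReal_mono (measure_ne_top _ _) h2

lemma integral_abs_gaussianReal_le : ∫ τ, |τ| ∂(gaussianReal 0 1) ≤ 1 := by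
  have hm := IsGaussian.memLp_two_id (μ := gaussianReal 0 1)
  have h2 : ∫ τ, τ ^ 2 ∂(gaussianReal 0 1) = 1 := by
    have := variance_id_gaussianReal (μ := 0) (v := 1)
    rw [variance_of_integral_eq_zero (by fun_prop) (by simp)] at this
    simpa using this
  have hi : Integrable (fun τ : ℝ => τ ^ 2) (gaussianReal 0 1) := hm.integrable_sq
  calc ∫ τ, |τ| ∂(gaussianReal 0 1) ≤ ∫ τ, (1 / 2 + 1 / 2 * τ ^ 2) ∂(gaussianReal 0 1) := by
        refine integral_mono (hm.integrable one_le_two).abs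
          ((integrable_const _).add (hi.const_mul _)) fun τ => ?_
        change |τ| ≤ 1 / 2 + 1 / 2 * τ ^ 2
        nlinarith [sq_nonneg (|τ| - 1), sq_abs τ]
    _ = 1 := by
        rw [integral_add (integrable_const _) (hi.const_mul _), integral_const_mul, h2]
        norm_num

lemma dilationFactor_sub_one_le {ρ θ : ℝ} (hρ : 0 < ρ) (hθ0 : 0 ≤ θ) (hθ1 : θ ≤ 1) (τ : ℝ) :
    dilationFactor ρ θ τ - 1 ≤ θ * (θ + 2 * ρ⁻¹ * |τ|) := by
  have hc := Real.one_sub_sq_div_two_le_cos (x := θ)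
  have hc2 : 1 / 2 ≤ Real.cos θ := by nlinarith
  have hs := Real.sin_le hθ0
  have hr : 0 ≤ ρ⁻¹ * |τ| := by positivity
  rw [dilationFactor, sub_le_iff_le_add, div_le_iff₀ (by linarith)]
  nlinarith [mul_le_mul_of_nonneg_right hs hr, mul_nonneg hθ0 hr,
    mul_nonneg (mul_nonneg hθ0 hr) (sub_nonneg.2 hc2), mul_nonneg (sq_nonneg θ) (sub_nonneg.2 hc2)]

/-- A function bounded above by `F 1 + 1` whose derivative at `1` is smaller than `d` is dominated
on `[1, ∞)` by a quadratic polynomial with linear coefficient `d`. -/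
lemma exists_quadratic_bound {F : ℝ → ℝ} {D d : ℝ} (hF : HasDerivAt F D 1) (hD : D < d)
    (hd : 0 ≤ d) (hF1 : ∀ t, F t - F 1 ≤ 1) :
    ∃ C, 0 ≤ C ∧ ∀ t, 1 ≤ t → F t - F 1 ≤ d * (t - 1) + C * (t - 1) ^ 2 := by
  have h := (hasDerivAt_iff_isLittleO.1 hF).def (sub_pos.2 hD)
  obtain ⟨δ, hδ, hb⟩ := Metric.eventually_nhds_iff.1 h
  refine ⟨(δ ^ 2)⁻¹, by positivity, fun t ht => ?_⟩
  have hsq : 0 ≤ (δ ^ 2)⁻¹ * (t - 1) ^ 2 := by positivity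
  have hlin : 0 ≤ d * (t - 1) := mul_nonneg hd (by linarith)
  by_cases htδ : t - 1 < δ
  · have := hb (y := t) (by rwa [Real.dist_eq, abs_of_nonneg (by linarith)])
    rw [Real.norm_eq_abs, Real.norm_of_nonneg (by linarith), smul_eq_mul] at this
    nlinarith [le_abs_self (F t - F 1 - (t - 1) * D)]
  · push Not at htδ
    have : 1 ≤ (δ ^ 2)⁻¹ * (t - 1) ^ 2 := by
      rw [inv_mul_eq_div, le_div_iff₀ (by positivity), one_mul]
      gcongr
    linarith [hF1 t]

/-- The Gaussian measure of dilates of a symmetric open convex set of measure close to `1 / 2`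
grows at a rate bounded below by an absolute constant. -/
lemma one_div_hundred_le_derivative {K : Set E} (hK : Convex ℝ K) (hKo : IsOpen K)
    (hKs : ∀ x ∈ K, -x ∈ K) (hv : |(γ E).real K - 1 / 2| ≤ 1 / 8) {D : ℝ}
    (hD : HasDerivAt (fun t : ℝ => (γ E).real {x | t⁻¹ • x ∈ K}) D 1) : 1 / 100 ≤ D := by
  by_contra! hlt
  obtain ⟨hv1, hv2⟩ := abs_le.1 hv
  have hne : K.Nonempty := by
    rw [Set.nonempty_iff_ne_empty]
    rintro rfl
    norm_num at hv1
  have hK0 : (0 : E) ∈ K := by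
    obtain ⟨x, hx⟩ := hne
    have := hK hx (hKs x hx) (a := 1 / 2) (b := 1 / 2) (by norm_num) (by norm_num) (by norm_num)
    simpa using this
  have hKρ : Metric.closedBall 0 (1 / 4) ⊆ K :=
    closedBall_subset_of_lt_stdGaussian hK hKo hK0 hKs (by linarith)
  obtain ⟨C, hC, hbound⟩ := exists_quadratic_bound hD hlt (by norm_num) fun t => by
    have h1 : (γ E).real {x | t⁻¹ • x ∈ K} ≤ 1 := measureReal_le_one
    have h2 : 0 ≤ (γ E).real {x | (1 : ℝ)⁻¹ • x ∈ K} := measureReal_nonneg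
    linarith
  simp only [inv_one, one_smul, Set.ofPred_mem_eq] at hbound
  have hm := IsGaussian.memLp_two_id (μ := gaussianReal 0 1)
  have hi1 : Integrable (fun τ : ℝ => |τ|) (gaussianReal 0 1) := (hm.integrable one_le_two).abs
  have hi2 : Integrable (fun τ : ℝ => (1 + 8 * |τ|) ^ 2) (gaussianReal 0 1) :=
    ((memLp_const (1 : ℝ)).add (hm.abs.const_mul 8)).integrable_sq
  set m := ∫ τ, |τ| ∂(gaussianReal 0 1) with hm_def
  set M := ∫ τ, (1 + 8 * |τ|) ^ 2 ∂(gaussianReal 0 1) with hM_def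
  have hexit : ∀ θ : ℝ, 0 < θ → θ ≤ 1 →
      exitProb K θ ≤ θ * (1 / 100 * (θ + 8 * m)) + C * θ ^ 2 * M := by
    intro θ hθ0 hθ1
    have hs : 0 < Real.sin θ := Real.sin_pos_of_pos_of_lt_pi hθ0 (by linarith [Real.pi_gt_three])
    have hc : 0 < Real.cos θ := by nlinarith [Real.one_sub_sq_div_two_le_cos (x := θ)]
    refine (exitProb_le_integral hK hKo (by norm_num) hKρ hs hc).trans ?_
    have hle : ∀ τ : ℝ, (γ E).real {x | (dilationFactor (1 / 4) θ τ)⁻¹ • x ∈ K} - (γ E).real K ≤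
        θ * (1 / 100 * (θ + 8 * |τ|)) + C * θ ^ 2 * (1 + 8 * |τ|) ^ 2 := by
      intro τ
      have hT1 := one_le_dilationFactor (ρ := 1 / 4) (by norm_num) hs hc τ
      have hT2 := dilationFactor_sub_one_le (ρ := 1 / 4) (by norm_num) hθ0.le hθ1 τ
      norm_num at hT2
      refine (hbound _ hT1).trans ?_
      have h3 : dilationFactor (1 / 4) θ τ - 1 ≤ θ * (1 + 8 * |τ|) := by
        norm_num
        nlinarith
      have h4 : (dilationFactor (1 / 4) θ τ - 1) ^ 2 ≤ (θ * (1 + 8 * |τ|)) ^ 2 :=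
        pow_le_pow_left₀ (by linarith) h3 2
      have h5 := mul_le_mul_of_nonneg_left h4 hC
      norm_num at h5 ⊢
      nlinarith
    calc _ ≤ ∫ τ, (θ * (1 / 100 * (θ + 8 * |τ|)) + C * θ ^ 2 * (1 + 8 * |τ|) ^ 2)
          ∂(gaussianReal 0 1) := by
          refine integral_mono_of_nonneg (ae_of_all _ fun τ => ?_) ?_ (ae_of_all _ hle)
          · have hT := one_le_dilationFactor (ρ := 1 / 4) (by norm_num) hs hc τ
            refine sub_nonneg.2 (measureReal_mono fun x hx => ?_)
            exact hK.smul_mem_of_zero_mem hK0 hx ⟨by positivity, inv_le_one_of_one_le₀ hT⟩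
          · exact ((((integrable_const θ).add (hi1.const_mul 8)).const_mul _).const_mul _).add
              (hi2.const_mul _)
      _ = _ := by
          rw [integral_add, integral_const_mul, integral_const_mul, integral_add,
            integral_const_mul, integral_const_mul]
          · simp [m, M]
          · exact integrable_const θ
          · exact hi1.const_mul 8
          · exact (((integrable_const θ).add (hi1.const_mul 8)).const_mul _).const_mul _
          · exact hi2.const_mul _
  have hmain : ∀ N : ℕ, 2 ≤ N → (γ E).real K * (1 - (γ E).real K) ≤
      Real.pi / 2 * (1 / 100 * (Real.pi / 2 / N + 8 * m) + C * (Real.pi / 2 / N) * M) := by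
    intro N hN
    have hN' : (2 : ℝ) ≤ N := by exact_mod_cast hN
    have hNθ : N * (Real.pi / 2 / N) = Real.pi / 2 := by field_simp
    have h1 := exitProb_nat_mul_le hKo.measurableSet (Real.pi / 2 / N) N
    rw [hNθ, exitProb_pi_div_two hKo.measurableSet] at h1
    have h2 := hexit (Real.pi / 2 / N) (by positivity) (by
      rw [div_le_one (by positivity)]
      linarith [Real.pi_lt_four])
    refine h1.trans ((mul_le_mul_of_nonneg_left h2 (by positivity)).trans_eq ?_)
    linear_combination (1 / 100 * (Real.pi / 2 / N + 8 * m) + C * (Real.pi / 2 / N) * M) * hNθ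
  have hlim : Filter.Tendsto (fun N : ℕ => Real.pi / 2 *
      (1 / 100 * (Real.pi / 2 / N + 8 * m) + C * (Real.pi / 2 / N) * M)) Filter.atTop
      (nhds (Real.pi / 2 * (1 / 100 * (0 + 8 * m) + C * 0 * M))) := by
    have h0 : Filter.Tendsto (fun N : ℕ => Real.pi / 2 / (N : ℝ)) Filter.atTop (nhds 0) :=
      tendsto_const_div_atTop_nhds_zero_nat _
    exact (((h0.add_const _).const_mul _).add ((h0.const_mul _).mul_const _)).const_mul _
  have hfin := ge_of_tendsto hlim (Filter.eventually_atTop.2 ⟨2, hmain⟩)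
  have hm1 : m ≤ 1 := integral_abs_gaussianReal_le
  have hm0 : 0 ≤ m := integral_nonneg fun τ => abs_nonneg τ
  have hpi := Real.pi_lt_four
  have hpi0 := Real.pi_pos
  have hpm : Real.pi * m ≤ 4 * 1 := mul_le_mul hpi.le hm1 hm0 (by norm_num)
  nlinarith

open Classical in
/-- The correlation of the centered indicator of a set with `r ^ 2 - ‖·‖ ^ 2` does not depend
on `r`. -/
lemma integral_centered_indicator_mul {A : Set E} (hA : MeasurableSet A) (r : ℝ) :
    ∫ g, ((if g ∈ A then (1 : ℝ) else 0) - (γ E).real A) * (r ^ 2 - ‖g‖ ^ 2) ∂(γ E) =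
      Module.finrank ℝ E * (γ E).real A - ∫ x in A, ‖x‖ ^ 2 ∂(γ E) := by
  have hi := integrable_sq_norm_stdGaussian (E := E)
  have h1 : Integrable (A.indicator fun _ => r ^ 2) (γ E) := (integrable_const _).indicator hA
  have h2 : Integrable (A.indicator fun x => ‖x‖ ^ 2) (γ E) := hi.indicator hA
  have heq : ∀ g : E, ((if g ∈ A then (1 : ℝ) else 0) - (γ E).real A) * (r ^ 2 - ‖g‖ ^ 2) =
      (A.indicator (fun _ => r ^ 2) g - A.indicator (fun x => ‖x‖ ^ 2) g) -
        (γ E).real A * (r ^ 2 - ‖g‖ ^ 2) := by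
    intro g
    by_cases hg : g ∈ A <;> simp [hg]
    ring
  have h3 : Integrable (fun g : E => r ^ 2 - ‖g‖ ^ 2) (γ E) := (integrable_const _).sub hi
  have h4 : Integrable (fun g => A.indicator (fun _ => r ^ 2) g - A.indicator (fun x => ‖x‖ ^ 2) g)
      (γ E) := h1.sub h2
  simp_rw [heq]
  rw [integral_sub h4 (h3.const_mul _), integral_sub h1 h2,
    integral_const_mul, integral_sub (integrable_const _) hi, integral_indicator hA,
    integral_indicator hA, integral_sq_norm_stdGaussian]
  simp
  ring

lemma stdGaussian_frontier {K : Set E} (hK : Convex ℝ K) : γ E (frontier K) = 0 := by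
  rw [stdGaussian_eq_withDensity_s16]
  exact withDensity_absolutelyContinuous _ _ (hK.addHaar_frontier volume)

lemma interior_ae_eq_of_convex {K : Set E} (hK : Convex ℝ K) : interior K =ᵐ[γ E] K :=
  interior_ae_eq_of_null_frontier (stdGaussian_frontier hK)

end Gaussian

lemma stdGaussian_eq (n : ℕ) :
    _root_.stdGaussian n = ProbabilityTheory.stdGaussian (EuclideanSpace ℝ (Fin n)) :=
  map_pi_eq_stdGaussian

open Classical in
/-- For a centrally symmetric convex set `K` with `|vol(K) - 1/2| ≤ c` and `r* > 0`
with `α_K(r*) = vol(K)`, the correlation of the recentered indicator of `K` with the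
quadratic `(r*)² - ‖g‖²` under the Gaussian is at least `c'`. -/
theorem correlation_with_ball_polynomial :
    ∃ c c' : ℝ, 0 < c ∧ 0 < c' ∧ ∃ n₀ : ℕ, ∀ n : ℕ, n₀ ≤ n →
      ∀ K : Set (EuclideanSpace ℝ (Fin n)),
        Convex ℝ K → (∀ x, x ∈ K ↔ -x ∈ K) →
        |gaussVol n K - 1 / 2| ≤ c →
        ∀ rstar : ℝ, 0 < rstar →
          shellDensity n K rstar = gaussVol n K →
          c' ≤ ∫ g, ((if g ∈ K then (1 : ℝ) else 0) - gaussVol n K)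
                  * (rstar ^ 2 - ‖g‖ ^ 2) ∂(stdGaussian n) := by
  refine ⟨1 / 8, 1 / 100, by norm_num, by norm_num, 0, fun n _ K hK hKs hv rstar _ _ => ?_⟩
  rw [gaussVol, stdGaussian_eq, ← measureReal_def] at *
  have hae := interior_ae_eq_of_convex hK
  have hvol : (ProbabilityTheory.stdGaussian (EuclideanSpace ℝ (Fin n))).real (interior K) =
      (ProbabilityTheory.stdGaussian (EuclideanSpace ℝ (Fin n))).real K := measureReal_congr hae
  have hint := integral_centered_indicator_mul isOpen_interior.measurableSet (A := interior K) rstar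
  rw [hvol] at hint
  have hneg : ∀ x ∈ interior K, -x ∈ interior K := by
    have hK' : -K = K := Set.ext fun x => (hKs x).symm
    intro x hx
    have h := (Homeomorph.neg (EuclideanSpace ℝ (Fin n))).preimage_interior K
    rw [Homeomorph.coe_neg, Set.neg_preimage, Set.neg_preimage, hK'] at h
    rw [← h] at hx
    exact hx
  have hD := one_div_hundred_le_derivative hK.interior isOpen_interior hneg (by rwa [hvol])
    (hasDerivAt_stdGaussian_dilate isOpen_interior.measurableSet)
  rw [hvol, ← hint] at hD
  refine hD.trans_eq (integral_congr_ae ?_)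
  filter_upwards [hae] with g hg
  have : g ∈ interior K ↔ g ∈ K := iff_of_eq hg
  simp only [this]
end
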